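/- Let D = D_h be a pseudoconvex balanced domain in ℂ² with h ≢ 0. Then every polynomial P ∈ ℂ[z₁,z₂] belongs to L²_h(D_h) if and only if ν(log h,[v]) = 0 for every v ∈ ℂ² ∖ {0}. -/

import Mathlib

open MeasureTheory Filter Topology
open scoped ENNReal NNReal

noncomputable section

/-- `f` belongs to the Bergman space `L²_h(D)`: holomorphic on `D` and square integrable. -/
def MemL2h {n : ℕ} (D : Set (Fin n → ℂ)) (f : (Fin n → ℂ) → ℂ) : Prop :=
  DifferentiableOn ℂ f D ∧ (∫⁻ z in D, (‖f z‖₊ : ℝ≥0∞) ^ 2) < ⊤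

/-- `h` is absolutely homogeneous. -/
def AbsHomog {n : ℕ} (h : (Fin n → ℂ) → ℝ) : Prop :=
  ∀ (c : ℂ) (z : Fin n → ℂ), h (c • z) = ‖c‖ * h z

/-- `log h` is plurisubharmonic (sub-mean value inequality on complex lines, where the
possibly `-∞`-valued integrand is handled via truncations `max · c`). -/
def LogPSH {n : ℕ} (h : (Fin n → ℂ) → ℝ) : Prop :=
  ∀ (a b : Fin n → ℂ) (r : ℝ), 0 < r → h a ≠ 0 → ∀ c : ℝ,
    Real.log (h a) ≤ (1 / (2 * Real.pi)) *
      ∫ θ in (0:ℝ)..(2 * Real.pi),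
        max (Real.log (h (a + ((r : ℂ) * Complex.exp (θ * Complex.I)) • b))) c

/-- `M_d(z)`: sup of `|P(z)|` over homogeneous polynomials `P` of degree `d` with
`∫_{D_h} |P|² dλ ≤ 1`. -/
def Md {n : ℕ} (h : (Fin n → ℂ) → ℝ) (d : ℕ) (z : Fin n → ℂ) : ℝ≥0∞ :=
  ⨆ (P : MvPolynomial (Fin n) ℂ) (_ : P.IsHomogeneous d)
    (_ : (∫⁻ w in {w | h w < 1}, (‖MvPolynomial.eval w P‖₊ : ℝ≥0∞) ^ 2) ≤ 1),
    (‖MvPolynomial.eval z P‖₊ : ℝ≥0∞)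

/-- `h_BK(z) = limsup_{d → ∞} M_d(z)^{1/d}`. -/
def hBK {n : ℕ} (h : (Fin n → ℂ) → ℝ) (z : Fin n → ℂ) : ℝ≥0∞ :=
  Filter.limsup (fun d : ℕ => (Md h d z) ^ (1 / (d : ℝ))) atTop

/-- Upper semicontinuous regularization of `h_BK`. -/
def hBKstar {n : ℕ} (h : (Fin n → ℂ) → ℝ) (z : Fin n → ℂ) : ℝ≥0∞ :=
  Filter.limsup (hBK h) (𝓝 z)

/-- The Bergman kernel of `D` on the diagonal. -/
def bergmanK {n : ℕ} (D : Set (Fin n → ℂ)) (z : Fin n → ℂ) : ℝ≥0∞ :=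
  ⨆ (f : (Fin n → ℂ) → ℂ) (_ : DifferentiableOn ℂ f D)
    (_ : (∫⁻ w in D, (‖f w‖₊ : ℝ≥0∞) ^ 2) ≤ 1), (‖f z‖₊ : ℝ≥0∞) ^ 2

/-- `D` is an `L²_h`-domain of holomorphy. -/
def IsL2hDomainOfHolomorphy {n : ℕ} (D : Set (Fin n → ℂ)) : Prop :=
  ¬ ∃ D₀ D₁ : Set (Fin n → ℂ), IsOpen D₀ ∧ IsOpen D₁ ∧ IsConnected D₀ ∧ IsConnected D₁ ∧
      D₀ ⊆ D₁ ∩ D ∧ ¬ (D₁ ⊆ D) ∧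
      ∀ f : (Fin n → ℂ) → ℂ, MemL2h D f →
        ∃ F : (Fin n → ℂ) → ℂ, DifferentiableOn ℂ F D₁ ∧ Set.EqOn F f D₀

/-- The Lelong number `ν(log h, [v])` of `log h` at the direction `[v] ∈ ℙ¹`. -/
def lelong (h : (Fin 2 → ℂ) → ℝ) (v : Fin 2 → ℂ) : ℝ :=
  if v 1 ≠ 0 then
    Filter.limsup (fun r : ℝ =>
      (⨆ θ : ℝ, Real.log (h ![v 0 + (r : ℂ) * Complex.exp (θ * Complex.I), v 1])) / Real.log r)
      (𝓝[>] 0)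
  else
    Filter.limsup (fun r : ℝ =>
      (⨆ θ : ℝ, Real.log (h ![v 0, (r : ℂ) * Complex.exp (θ * Complex.I)])) / Real.log r)
      (𝓝[>] 0)

/-- `m(Q,[v])`: the largest `k` such that `(v₂ z₁ - v₁ z₂)^k` divides `Q`. -/
def multAt (v : Fin 2 → ℂ) (Q : MvPolynomial (Fin 2) ℂ) : ℕ :=
  sSup {k : ℕ |
    (MvPolynomial.C (v 1) * MvPolynomial.X 0 - MvPolynomial.C (v 0) * MvPolynomial.X 1) ^ k ∣ Q}


/-- The Gaussian kernel on `ℂ` with `∫ ‖z‖² = s`. -/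
def heatKernel (s : ℝ) (z : ℂ) : ℝ≥0∞ :=
  ENNReal.ofReal ((Real.pi * s)⁻¹ * Real.exp (-(‖z‖ ^ 2 / s)))

/-- Convolution with the Gaussian kernel. -/
def heatOp (s : ℝ) (v : ℂ → ℝ≥0∞) (x : ℂ) : ℝ≥0∞ :=
  ∫⁻ w, heatKernel s (x - w) * v w

@[fun_prop]
lemma measurable_heatKernel (s : ℝ) : Measurable (heatKernel s) := by
  unfold heatKernel; fun_prop

lemma heatKernel_neg (s : ℝ) (z : ℂ) : heatKernel s (-z) = heatKernel s z := by
  simp [heatKernel]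

lemma lintegral_exp_neg_mul_sq_norm {b : ℝ} (hb : 0 < b) :
    ∫⁻ z : ℂ, ENNReal.ofReal (Real.exp (-(b * ‖z‖ ^ 2))) = ENNReal.ofReal (Real.pi / b) := by
  have h := GaussianFourier.integral_rexp_neg_mul_sq_norm (V := ℂ) hb
  have hi : Integrable (fun z : ℂ => Real.exp (-b * ‖z‖ ^ 2)) := by
    by_contra hc
    rw [integral_undef hc] at h
    have : (0 : ℝ) < (Real.pi / b) ^ ((Module.finrank ℝ ℂ : ℝ) / 2) := by positivity
    linarith
  simp only [Complex.finrank_real_complex, Nat.cast_ofNat, div_self (two_ne_zero (α := ℝ)),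
    Real.rpow_one] at h
  rw [← h, ofReal_integral_eq_lintegral_ofReal hi (ae_of_all _ fun z => (Real.exp_pos _).le)]
  simp

lemma lintegral_heatKernel {s : ℝ} (hs : 0 < s) : ∫⁻ z, heatKernel s z = 1 := by
  have h1 : ∀ z, heatKernel s z = ENNReal.ofReal (Real.pi * s)⁻¹ *
      ENNReal.ofReal (Real.exp (-(s⁻¹ * ‖z‖ ^ 2))) := by
    intro z
    rw [heatKernel, ENNReal.ofReal_mul (by positivity), div_eq_inv_mul]
  simp_rw [h1]
  rw [lintegral_const_mul _ (by fun_prop), lintegral_exp_neg_mul_sq_norm (by positivity),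
    ← ENNReal.ofReal_mul (by positivity)]
  rw [ENNReal.ofReal_eq_one]
  field_simp

lemma lintegral_heatKernel_sub {s : ℝ} (hs : 0 < s) (x : ℂ) :
    ∫⁻ w, heatKernel s (x - w) = 1 := by
  rw [lintegral_sub_left_eq_self (heatKernel s) x, lintegral_heatKernel hs]

lemma heatOp_const {s : ℝ} (hs : 0 < s) (c : ℝ≥0∞) (x : ℂ) : heatOp s (fun _ => c) x = c := by
  rw [heatOp, lintegral_mul_const _ (by fun_prop), lintegral_heatKernel_sub hs, one_mul]

lemma heatOp_add (s : ℝ) {v w : ℂ → ℝ≥0∞} (hv : Measurable v) (x : ℂ) :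
    heatOp s (fun z => v z + w z) x = heatOp s v x + heatOp s w x := by
  simp only [heatOp, mul_add]
  rw [lintegral_add_left (by fun_prop)]

lemma heatOp_mono (s : ℝ) {v w : ℂ → ℝ≥0∞} (h : ∀ z, v z ≤ w z) (x : ℂ) :
    heatOp s v x ≤ heatOp s w x :=
  lintegral_mono fun z => by gcongr; exact h z

@[fun_prop]
lemma measurable_heatOp (s : ℝ) {v : ℂ → ℝ≥0∞} (hv : Measurable v) : Measurable (heatOp s v) := by
  unfold heatOp
  exact Measurable.lintegral_prod_right' (f := fun q : ℂ × ℂ => heatKernel s (q.1 - q.2) * v q.2)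
    (by fun_prop)

lemma heatKernel_conv {s t : ℝ} (hs : 0 < s) (ht : 0 < t) (x w : ℂ) :
    ∫⁻ y, heatKernel s (x - y) * heatKernel t (y - w) = heatKernel (s + t) (x - w) := by
  have hst : 0 < s + t := by positivity
  set z := x - w with hz
  have key : ∀ y : ℂ, heatKernel s (x - y) * heatKernel t (y - w) =
      ENNReal.ofReal ((Real.pi * s)⁻¹ * (Real.pi * t)⁻¹ * Real.exp (-(‖z‖ ^ 2 / (s + t)))) *
      ENNReal.ofReal (Real.exp (-((s + t) / (s * t) * ‖y - (w + ((t / (s + t) : ℝ) : ℂ) * z)‖ ^ 2))) := by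
    intro y
    rw [heatKernel, heatKernel, ← ENNReal.ofReal_mul (by positivity),
      ← ENNReal.ofReal_mul (by positivity)]
    congr 1
    rw [mul_mul_mul_comm, ← Real.exp_add, mul_assoc _ (Real.exp _), ← Real.exp_add]
    congr 2
    simp only [hz, ← Complex.normSq_eq_norm_sq, Complex.normSq_apply, Complex.sub_re,
      Complex.sub_im, Complex.add_re, Complex.add_im, Complex.re_ofReal_mul, Complex.im_ofReal_mul]
    field_simp
    ring
  simp_rw [key]
  rw [lintegral_const_mul _ (by fun_prop), lintegral_sub_right_eq_self
    (fun y : ℂ => ENNReal.ofReal (Real.exp (-((s + t) / (s * t) * ‖y‖ ^ 2)))),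
    lintegral_exp_neg_mul_sq_norm (by positivity), ← ENNReal.ofReal_mul (by positivity), heatKernel]
  congr 1
  field_simp

lemma heatOp_heatOp {s t : ℝ} (hs : 0 < s) (ht : 0 < t) {v : ℂ → ℝ≥0∞} (hv : Measurable v)
    (x : ℂ) : heatOp s (heatOp t v) x = heatOp (s + t) v x := by
  simp only [heatOp]
  simp_rw [← heatKernel_conv hs ht]
  have : ∀ w, heatKernel s (x - w) * ∫⁻ y, heatKernel t (w - y) * v y =
      ∫⁻ y, heatKernel s (x - w) * (heatKernel t (w - y) * v y) := fun w => by
    rw [lintegral_const_mul _ (by fun_prop)]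
  simp_rw [this]
  rw [lintegral_lintegral_swap (by fun_prop)]
  refine lintegral_congr fun y => ?_
  rw [← lintegral_mul_const _ (by fun_prop)]
  simp_rw [mul_assoc]

/-- Gaussians with different centres and widths are comparable. -/
lemma heatKernel_sub_le {s s' : ℝ} (hs : 0 < s) (hss : 2 * s ≤ s') (x y w : ℂ) :
    heatKernel s (x - w) ≤
      ENNReal.ofReal (s' / s * Real.exp (2 * ‖x - y‖ ^ 2 / s')) * heatKernel s' (y - w) := by
  have hs' : 0 < s' := by linarith
  rw [heatKernel, heatKernel, ← ENNReal.ofReal_mul (by positivity)]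
  apply ENNReal.ofReal_le_ofReal
  have h1 : ‖y - w‖ ^ 2 ≤ 2 * ‖x - w‖ ^ 2 + 2 * ‖x - y‖ ^ 2 := by
    have : ‖y - w‖ ≤ ‖x - w‖ + ‖x - y‖ := by
      have := norm_sub_le (x - w) (x - y)
      simpa using this
    nlinarith [norm_nonneg (y - w), sq_nonneg (‖x - w‖ - ‖x - y‖)]
  have h2 : -(‖x - w‖ ^ 2 / s) ≤ 2 * ‖x - y‖ ^ 2 / s' + -(‖y - w‖ ^ 2 / s') := by
    have h3 : ‖y - w‖ ^ 2 / s' ≤ (2 * ‖x - w‖ ^ 2 + 2 * ‖x - y‖ ^ 2) / s' := by gcongr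
    have h4 : 2 * ‖x - w‖ ^ 2 / s' ≤ ‖x - w‖ ^ 2 / s := by
      rw [div_le_div_iff₀ hs' hs]
      nlinarith [sq_nonneg ‖x - w‖]
    rw [add_div] at h3
    linarith
  calc (Real.pi * s)⁻¹ * Real.exp (-(‖x - w‖ ^ 2 / s))
      ≤ (Real.pi * s)⁻¹ * Real.exp (2 * ‖x - y‖ ^ 2 / s' + -(‖y - w‖ ^ 2 / s')) := by gcongr
    _ = _ := by rw [Real.exp_add]; field_simp

lemma heatOp_le {s s' : ℝ} (hs : 0 < s) (hss : 2 * s ≤ s') (x y : ℂ) {v : ℂ → ℝ≥0∞} :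
    heatOp s v x ≤
      ENNReal.ofReal (s' / s * Real.exp (2 * ‖x - y‖ ^ 2 / s')) * heatOp s' v y := by
  rw [heatOp, heatOp, ← lintegral_const_mul' _ _ ENNReal.ofReal_ne_top]
  refine lintegral_mono fun w => ?_
  rw [← mul_assoc]
  gcongr
  exact heatKernel_sub_le hs hss x y w

/-- A nonnegative function is superharmonic up to a multiple of the time, for the heat flow. -/
structure HeatSuper (v : ℂ → ℝ≥0∞) (C : ℝ≥0) : Prop where
  lsc : LowerSemicontinuous v
  super : ∀ s : ℝ, 0 < s → ∀ x, heatOp s v x ≤ v x + ENNReal.ofReal (C * s)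
  fin : ∃ x, v x ≠ ⊤

namespace HeatSuper

variable {v : ℂ → ℝ≥0∞} {C : ℝ≥0}

lemma meas (hv : HeatSuper v C) : Measurable v := hv.lsc.measurable

lemma heatOp_ne_top (hv : HeatSuper v C) {s : ℝ} (hs : 0 < s) (x : ℂ) : heatOp s v x ≠ ⊤ := by
  obtain ⟨y, hy⟩ := hv.fin
  refine ne_top_of_le_ne_top ?_ (heatOp_le hs le_rfl x y)
  refine ENNReal.mul_ne_top ENNReal.ofReal_ne_top ?_
  exact ne_top_of_le_ne_top (ENNReal.add_ne_top.2 ⟨hy, ENNReal.ofReal_ne_top⟩)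
    (hv.super _ (by positivity) y)

lemma heatOp_add_le (hv : HeatSuper v C) {s t : ℝ} (hs : 0 < s) (ht : 0 < t) (x : ℂ) :
    heatOp (s + t) v x ≤ heatOp s v x + ENNReal.ofReal (C * t) := by
  rw [← heatOp_heatOp hs ht hv.meas]
  refine (heatOp_mono s (hv.super t ht) x).trans ?_
  rw [heatOp_add s hv.meas, heatOp_const hs]

/-- The defect of the super-mean value inequality at time `e`. -/
def defect (v : ℂ → ℝ≥0∞) (C : ℝ≥0) (e : ℝ) (x : ℂ) : ℝ≥0∞ :=
  v x + ENNReal.ofReal (C * e) - heatOp e v x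

lemma measurable_defect (hv : HeatSuper v C) (e : ℝ) : Measurable (defect v C e) := by
  have := hv.meas
  unfold defect
  fun_prop

lemma heatOp_defect (hv : HeatSuper v C) {s e : ℝ} (hs : 0 < s) (he : 0 < e) (x : ℂ) :
    heatOp s (defect v C e) x + heatOp (s + e) v x = heatOp s v x + ENNReal.ofReal (C * e) := by
  rw [← heatOp_heatOp hs he hv.meas, ← heatOp_add s (hv.measurable_defect e)]
  have : (fun z => defect v C e z + heatOp e v z) = fun z => v z + ENNReal.ofReal (C * e) := by
    ext z
    exact tsub_add_cancel_of_le (hv.super e he z)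
  rw [this, heatOp_add s hv.meas, heatOp_const hs]

lemma sum_heatOp_defect (hv : HeatSuper v C) {e : ℝ} (he : 0 < e) {j : ℕ} (hj : 0 < j) (n : ℕ)
    (x : ℂ) :
    (∑ k ∈ Finset.range n, heatOp ((j + k : ℕ) * e) (defect v C e) x) + heatOp ((j + n : ℕ) * e) v x
      = heatOp (j * e) v x + ENNReal.ofReal (C * (n * e)) := by
  induction n with
  | zero => simp
  | succ n ih =>
    rw [Finset.sum_range_succ, add_assoc]
    have h1 : ((j + (n + 1) : ℕ) : ℝ) * e = (j + n : ℕ) * e + e := by push_cast; ring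
    have h2 : 0 < ((j + n : ℕ) : ℝ) * e := by positivity
    rw [h1, hv.heatOp_defect h2 he, ← add_assoc, ih, add_assoc, ← ENNReal.ofReal_add (by positivity)
      (by positivity)]
    congr 2
    push_cast; ring

lemma sum_heatOp_defect_le (hv : HeatSuper v C) {e : ℝ} (he : 0 < e) {j : ℕ} (hj : 0 < j) (n : ℕ)
    (x : ℂ) :
    ∑ k ∈ Finset.range n, heatOp ((j + k : ℕ) * e) (defect v C e) x
      ≤ heatOp (j * e) v x + ENNReal.ofReal (C * (n * e)) := by
  rw [← hv.sum_heatOp_defect he hj]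
  exact le_self_add

end HeatSuper

lemma one_div_le_log_sub {a e : ℝ} (ha : 0 < a) (he : 0 < e) :
    e / (a + e) ≤ Real.log (a + e) - Real.log a := by
  rw [← Real.log_div (by positivity) ha.ne']
  have := Real.one_sub_inv_le_log_of_pos (x := (a + e) / a) (by positivity)
  refine le_trans (le_of_eq ?_) this
  field_simp
  ring

/-- Upper bound for the discrete Green function of the heat flow. -/
lemma sum_heatKernel_le {e : ℝ} (he : 0 < e) (n : ℕ) {z : ℂ} (hz : z ≠ 0) :
    ∑ k ∈ Finset.range n, heatKernel ((1 + k : ℕ) * e) z ≤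
      ENNReal.ofReal (e⁻¹ * (Real.log (1 + n * e / ‖z‖ ^ 2) / Real.pi)) := by
  have hz' : 0 < ‖z‖ := norm_pos_iff.2 hz
  unfold heatKernel
  rw [← ENNReal.ofReal_sum_of_nonneg (fun _ _ => by positivity)]
  apply ENNReal.ofReal_le_ofReal
  have h1 : ∀ k : ℕ, (Real.pi * ((1 + k : ℕ) * e))⁻¹ * Real.exp (-(‖z‖ ^ 2 / ((1 + k : ℕ) * e))) ≤
      (Real.pi * e)⁻¹ * (Real.log (‖z‖ ^ 2 + (k + 1 : ℕ) * e) - Real.log (‖z‖ ^ 2 + k * e)) := by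
    intro k
    have h2 := one_div_le_log_sub (a := ‖z‖ ^ 2 + k * e) (by positivity) he
    have h3 : ‖z‖ ^ 2 + (k + 1 : ℕ) * e = ‖z‖ ^ 2 + k * e + e := by push_cast; ring
    rw [h3]
    set s : ℝ := (1 + k : ℕ) * e with hs
    have hs0 : 0 < s := by positivity
    have h4 : Real.exp (-(‖z‖ ^ 2 / s)) ≤ (1 + ‖z‖ ^ 2 / s)⁻¹ := by
      rw [Real.exp_neg]
      gcongr
      linarith [Real.add_one_le_exp (‖z‖ ^ 2 / s)]
    calc _ ≤ (Real.pi * s)⁻¹ * (1 + ‖z‖ ^ 2 / s)⁻¹ := by gcongr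
      _ = (Real.pi * e)⁻¹ * (e / (‖z‖ ^ 2 + k * e + e)) := by
        have : ‖z‖ ^ 2 + k * e + e = s + ‖z‖ ^ 2 := by rw [hs]; push_cast; ring
        rw [this]
        field_simp
      _ ≤ _ := by gcongr
  refine (Finset.sum_le_sum fun k _ => h1 k).trans ?_
  rw [← Finset.mul_sum, Finset.sum_range_sub (fun k : ℕ => Real.log (‖z‖ ^ 2 + k * e)),
    ← Real.log_div (by positivity) (by simp [hz])]
  apply le_of_eq
  have : (‖z‖ ^ 2 + n * e) / (‖z‖ ^ 2 + (0 : ℕ) * e) = 1 + n * e / ‖z‖ ^ 2 := by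
    simp; field_simp
  rw [this]
  field_simp

lemma le_sum_heatKernel {e : ℝ} (he : 0 < e) {j : ℕ} (hj : 0 < j) (n : ℕ) {z : ℂ}
    (hz : ‖z‖ ^ 2 ≤ j * e) :
    ENNReal.ofReal (e⁻¹ * (Real.log ((j + n) / j) / (Real.pi * Real.exp 1))) ≤
      ∑ k ∈ Finset.range n, heatKernel ((j + k : ℕ) * e) z := by
  have hj' : (0 : ℝ) < j := by positivity
  unfold heatKernel
  rw [← ENNReal.ofReal_sum_of_nonneg (fun _ _ => by positivity)]
  apply ENNReal.ofReal_le_ofReal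
  have h1 : ∀ k : ℕ, (Real.pi * e * Real.exp 1)⁻¹ *
      (Real.log (j + (k + 1 : ℕ)) - Real.log (j + k)) ≤
      (Real.pi * ((j + k : ℕ) * e))⁻¹ * Real.exp (-(‖z‖ ^ 2 / ((j + k : ℕ) * e))) := by
    intro k
    have h0 : (0 : ℝ) < j + k := by positivity
    have h2 : Real.log (j + (k + 1 : ℕ)) - Real.log (j + k) ≤ 1 / (j + k) := by
      rw [← Real.log_div (by positivity) (by positivity)]
      refine (Real.log_le_sub_one_of_pos (by positivity)).trans (le_of_eq ?_)
      push_cast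
      field_simp
      ring
    have h3 : Real.exp (-1) ≤ Real.exp (-(‖z‖ ^ 2 / ((j + k : ℕ) * e))) := by
      apply Real.exp_le_exp.2
      rw [neg_le_neg_iff, div_le_one (by positivity)]
      refine hz.trans ?_
      push_cast
      gcongr
      linarith [(Nat.cast_nonneg k : (0 : ℝ) ≤ k)]
    calc _ ≤ (Real.pi * e * Real.exp 1)⁻¹ * (1 / (j + k)) := by gcongr
      _ = (Real.pi * ((j + k : ℕ) * e))⁻¹ * Real.exp (-1) := by
        rw [Real.exp_neg]; push_cast; field_simp
      _ ≤ _ := by gcongr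
  refine le_trans ?_ (Finset.sum_le_sum fun k _ => h1 k)
  rw [← Finset.mul_sum, Finset.sum_range_sub (fun k : ℕ => Real.log (j + k)),
    ← Real.log_div (by positivity) (by simp [hj.ne'])]
  apply le_of_eq
  simp only [Nat.cast_zero, add_zero]
  field_simp

/-- Far from the centre, short-time Gaussians are dominated by a long-time one. -/
lemma heatKernel_far_le {s r : ℝ} (hs : 0 < s) (hs1 : s ≤ 1) (hr : 0 < r) {z y : ℂ}
    (hz : r ≤ ‖z‖) (hy : ‖y‖ ≤ 2 * ‖z‖) :
    heatKernel s z ≤ ENNReal.ofReal (18 / r ^ 2) * heatKernel (8 + s) y := by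
  rw [heatKernel, heatKernel, ← ENNReal.ofReal_mul (by positivity)]
  apply ENNReal.ofReal_le_ofReal
  set q := ‖z‖ ^ 2 with hq
  have hrq : r ^ 2 ≤ q := by rw [hq]; gcongr
  have hq0 : 0 < q := by nlinarith [sq_pos_of_pos hr]
  have h1 : Real.exp (-(q / s)) ≤ 2 * s / q * Real.exp (-(q / 2)) := by
    have h2 : Real.exp (-(q / s)) = Real.exp (-(q / (2 * s))) * Real.exp (-(q / (2 * s))) := by
      rw [← Real.exp_add]; congr 1; field_simp; norm_num
    rw [h2]
    gcongr
    · rw [Real.exp_neg]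
      have : 2 * s / q = (q / (2 * s))⁻¹ := by field_simp
      rw [this]
      gcongr
      linarith [Real.add_one_le_exp (q / (2 * s))]
    · linarith
  have h3 : Real.exp (-(q / 2)) ≤ Real.exp (-(‖y‖ ^ 2 / (8 + s))) := by
    apply Real.exp_le_exp.2
    rw [neg_le_neg_iff, div_le_div_iff₀ (by positivity) (by positivity)]
    have : ‖y‖ ^ 2 ≤ 4 * q := by
      rw [hq]; nlinarith [norm_nonneg y]
    nlinarith
  calc (Real.pi * s)⁻¹ * Real.exp (-(q / s))
      ≤ (Real.pi * s)⁻¹ * (2 * s / q * Real.exp (-(‖y‖ ^ 2 / (8 + s)))) := by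
        gcongr; exact h1.trans (by gcongr)
    _ = 2 / q * (Real.pi⁻¹ * Real.exp (-(‖y‖ ^ 2 / (8 + s)))) := by field_simp
    _ ≤ 2 / r ^ 2 * (9 / (8 + s) * Real.pi⁻¹ * Real.exp (-(‖y‖ ^ 2 / (8 + s)))) := by
        gcongr
        rw [le_mul_iff_one_le_left (by positivity), one_le_div (by positivity)]
        linarith
    _ = _ := by field_simp; norm_num

namespace HeatSuper
variable {v : ℂ → ℝ≥0∞} {C : ℝ≥0}

lemma sum_heatOp_eq (s : ℕ → ℝ) (n : ℕ) {f : ℂ → ℝ≥0∞} (hf : Measurable f) (x : ℂ) :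
    ∑ k ∈ Finset.range n, heatOp (s k) f x =
      ∫⁻ w, (∑ k ∈ Finset.range n, heatKernel (s k) (x - w)) * f w := by
  simp only [heatOp, Finset.sum_mul]
  rw [lintegral_finsetSum _ (fun k _ => by fun_prop)]

/-- Normalised bound for the mass of the defect near `x₀`. -/
def massBound (v : ℂ → ℝ≥0∞) (C : ℝ≥0) (x₀ : ℂ) (m : ℕ) : ℝ≥0∞ :=
  ENNReal.ofReal (Real.pi * Real.exp 1 / Real.log m) * (heatOp (m : ℝ)⁻¹ v x₀ + C)

lemma massBound_ne_top (hv : HeatSuper v C) (x₀ : ℂ) {m : ℕ} (hm : 2 ≤ m) :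
    massBound v C x₀ m ≠ ⊤ :=
  ENNReal.mul_ne_top ENNReal.ofReal_ne_top
    (ENNReal.add_ne_top.2 ⟨hv.heatOp_ne_top (by positivity) _, ENNReal.coe_ne_top⟩)

lemma defect_mass_le (hv : HeatSuper v C) (x₀ : ℂ) {m j : ℕ} (hm : 2 ≤ m) (hj : 0 < j) :
    ENNReal.ofReal (m * j) *
      ∫⁻ w in {w | ‖x₀ - w‖ ^ 2 ≤ (m : ℝ)⁻¹}, defect v C ((m * j : ℝ)⁻¹) w
      ≤ massBound v C x₀ m := by
  have hm0 : (0 : ℝ) < m := by positivity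
  have hj0 : (0 : ℝ) < j := by positivity
  set e : ℝ := (m * j : ℝ)⁻¹ with he
  have he0 : 0 < e := by positivity
  have hlog : 0 < Real.log m := Real.log_pos (by exact_mod_cast hm)
  have hje : j * e = (m : ℝ)⁻¹ := by rw [he]; field_simp
  have h1 := hv.sum_heatOp_defect_le he0 hj (m * j - j) x₀
  rw [sum_heatOp_eq _ _ (hv.measurable_defect e), hje] at h1
  have hcast : ((m * j - j : ℕ) : ℝ) = m * j - j := by
    rw [Nat.cast_sub (Nat.le_mul_of_pos_left _ (by omega))]; push_cast; ring
  have h2 : heatOp (m : ℝ)⁻¹ v x₀ + ENNReal.ofReal (C * ((m * j - j : ℕ) * e)) ≤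
      heatOp (m : ℝ)⁻¹ v x₀ + C := by
    gcongr
    rw [← ENNReal.ofReal_coe_nnreal]
    apply ENNReal.ofReal_le_ofReal
    apply mul_le_of_le_one_right C.2
    rw [hcast, he, ← div_eq_mul_inv, div_le_one (by positivity)]
    linarith
  set S : Set ℂ := {w | ‖x₀ - w‖ ^ 2 ≤ (m : ℝ)⁻¹} with hS
  have hSm : MeasurableSet S := measurableSet_le (by fun_prop) (by fun_prop)
  have h3 : ENNReal.ofReal (e⁻¹ * (Real.log m / (Real.pi * Real.exp 1))) * ∫⁻ w in S, defect v C e w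
      ≤ heatOp (m : ℝ)⁻¹ v x₀ + C := by
    refine le_trans ?_ (h1.trans h2)
    rw [← lintegral_const_mul _ (hv.measurable_defect e)]
    refine le_trans (setLIntegral_mono' hSm fun w hw => ?_) (setLIntegral_le_lintegral S _)
    gcongr
    have := le_sum_heatKernel he0 hj (m * j - j) (z := x₀ - w) (by rw [hje]; exact hw)
    rwa [hcast, show ((j : ℝ) + (m * j - j)) / j = m by field_simp; ring] at this
  unfold massBound
  refine le_trans (le_of_eq ?_) (mul_le_mul_right h3 _)
  rw [← mul_assoc, ← ENNReal.ofReal_mul (by positivity)]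
  congr 2
  rw [he]
  field_simp

/-- Local representation: up to a bounded error, the heat regularisations of `v` near `x₀` are
logarithmic potentials of measures of controlled mass. -/
lemma exists_potential_bound (hv : HeatSuper v C) (x₀ : ℂ) {m : ℕ} (hm : 2 ≤ m) :
    ∃ K : ℝ≥0, ∀ j : ℕ, 0 < j → ∃ ν : Measure ℂ, ν Set.univ ≤ massBound v C x₀ m ∧
      (∀ᵐ w ∂ν, ‖x₀ - w‖ ^ 2 ≤ (m : ℝ)⁻¹) ∧ 
      ∀ x, ‖x - x₀‖ ≤ √(m : ℝ)⁻¹ / 2 → heatOp ((m * j : ℝ)⁻¹) v x ≤ 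
        K + ∫⁻ w, ENNReal.ofReal (Real.log (1 + 1 / ‖x - w‖ ^ 2) / Real.pi) ∂ν := by
  have hm0 : (0 : ℝ) < m := by positivity
  set r : ℝ := √(m : ℝ)⁻¹ / 2 with hr
  have hr0 : 0 < r := by positivity
  have hr1 : r ≤ 1 := by
    have : √(m : ℝ)⁻¹ ≤ 1 := by
      rw [Real.sqrt_le_one]
      exact inv_le_one_of_one_le₀ (by exact_mod_cast (by omega : 1 ≤ m))
    linarith
  have h4r : (2 * r) ^ 2 = (m : ℝ)⁻¹ := by
    rw [hr, mul_div_cancel₀ _ two_ne_zero, Real.sq_sqrt (by positivity)]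
  set K1 : ℝ≥0∞ := ENNReal.ofReal (2 / 1 * Real.exp (2 * 1 ^ 2 / 2)) * heatOp 2 v x₀ + C with hK1
  set K2 : ℝ≥0∞ := ENNReal.ofReal (18 / r ^ 2) * (heatOp 8 v x₀ + C + C) with hK2
  have hC := ENNReal.coe_ne_top (r := C)
  have hK1t : K1 ≠ ⊤ := ENNReal.add_ne_top.2 ⟨ENNReal.mul_ne_top ENNReal.ofReal_ne_top
    (hv.heatOp_ne_top (by norm_num) _), hC⟩
  have hK2t : K2 ≠ ⊤ := ENNReal.mul_ne_top ENNReal.ofReal_ne_top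
    (ENNReal.add_ne_top.2 ⟨ENNReal.add_ne_top.2 ⟨hv.heatOp_ne_top (by norm_num) _, hC⟩, hC⟩)
  refine ⟨(K1 + K2).toNNReal, fun j hj => ?_⟩
  rw [ENNReal.coe_toNNReal (ENNReal.add_ne_top.2 ⟨hK1t, hK2t⟩)]
  have hj0 : (0 : ℝ) < j := by positivity
  have hj1 : (1 : ℝ) ≤ j := by exact_mod_cast hj
  set e : ℝ := (m * j : ℝ)⁻¹ with he
  have he0 : 0 < e := by positivity
  have he1 : e ≤ 1 := by
    rw [he]; apply inv_le_one_of_one_le₀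
    have : (1 : ℝ) ≤ m := by exact_mod_cast (by omega : 1 ≤ m)
    nlinarith
  have hNe : ((m * j : ℕ) : ℝ) * e = 1 := by rw [he]; push_cast; field_simp
  have hCe : ENNReal.ofReal (C * e) ≤ C := by
    rw [← ENNReal.ofReal_coe_nnreal]
    exact ENNReal.ofReal_le_ofReal (mul_le_of_le_one_right C.2 he1)
  have hdm := hv.measurable_defect e
  set S : Set ℂ := {w | ‖x₀ - w‖ ^ 2 ≤ (m : ℝ)⁻¹} with hS
  have hSm : MeasurableSet S := measurableSet_le (by fun_prop) (by fun_prop)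
  refine ⟨(volume.restrict S).withDensity (fun w => ENNReal.ofReal (m * j) * defect v C e w),
    ?_, ?_, fun x hx => ?_⟩
  · rw [withDensity_apply _ MeasurableSet.univ, setLIntegral_univ, lintegral_const_mul _ hdm]
    exact hv.defect_mass_le x₀ hm hj
  · exact (withDensity_absolutelyContinuous _ _).ae_le (ae_restrict_mem hSm)
  have hxn : ‖x - x₀‖ ≤ r := hx
  have h1 := hv.sum_heatOp_defect he0 one_pos (m * j) x
  rw [Nat.cast_one, one_mul] at h1
  have h2 : heatOp e v x ≤ heatOp ((1 + m * j : ℕ) * e) v x +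
      ∑ k ∈ Finset.range (m * j), heatOp ((1 + k : ℕ) * e) (defect v C e) x := by
    rw [add_comm, h1]; exact le_self_add
  have h3 : heatOp ((1 + m * j : ℕ) * e) v x ≤ K1 := by
    have : ((1 + m * j : ℕ) : ℝ) * e = 1 + e := by
      rw [Nat.cast_add, add_mul, hNe]; push_cast; ring
    rw [this]
    refine (hv.heatOp_add_le one_pos he0 x).trans ?_
    rw [hK1]
    gcongr
    refine (heatOp_le one_pos (s' := 2) (by norm_num) x x₀).trans ?_
    gcongr
    linarith
  have h4 : ∑ k ∈ Finset.range (m * j), heatOp ((1 + k : ℕ) * e) (defect v C e) x ≤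
      K2 + ∫⁻ w in S, ENNReal.ofReal (Real.log (1 + 1 / ‖x - w‖ ^ 2) / Real.pi) *
        (ENNReal.ofReal (m * j) * defect v C e w) := by
    rw [sum_heatOp_eq _ _ hdm, ← lintegral_add_compl _ hSm, add_comm]
    gcongr ?_ + ?_
    · have h5 := hv.sum_heatOp_defect_le he0 (j := 8 * (m * j) + 1) (by omega) (m * j) x₀
      have h6 : heatOp (((8 * (m * j) + 1 : ℕ) : ℝ) * e) v x₀ ≤ heatOp 8 v x₀ + C := by
        have : ((8 * (m * j) + 1 : ℕ) : ℝ) * e = 8 + e := by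
          rw [Nat.cast_add, Nat.cast_mul, add_mul, mul_assoc, hNe]; push_cast; ring
        rw [this]
        exact (hv.heatOp_add_le (by norm_num) he0 x₀).trans (by gcongr)
      rw [hNe, mul_one, ENNReal.ofReal_coe_nnreal] at h5
      refine le_trans ?_ (mul_le_mul_right (h5.trans (add_le_add_left h6 _)) _)
      rw [sum_heatOp_eq _ _ hdm, ← lintegral_const_mul' _ _ ENNReal.ofReal_ne_top]
      refine le_trans (setLIntegral_mono' hSm.compl fun w hw => ?_) (setLIntegral_le_lintegral _ _)
      rw [← mul_assoc, Finset.mul_sum]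
      gcongr with k hk
      have hw' : 2 * r ≤ ‖x₀ - w‖ := by
        simp only [hS, Set.mem_compl_iff, Set.mem_ofPred_eq, not_le, ← h4r] at hw
        exact (lt_of_pow_lt_pow_left₀ 2 (norm_nonneg _) hw).le
      have htri : ‖x₀ - w‖ ≤ ‖x - x₀‖ + ‖x - w‖ := by
        have := norm_sub_le (x - w) (x - x₀)
        simp only [sub_sub_sub_cancel_left] at this
        linarith
      have hse : ((8 * (m * j) + 1 + k : ℕ) : ℝ) * e = 8 + (1 + k : ℕ) * e := by
        rw [add_assoc, Nat.cast_add, Nat.cast_mul, add_mul, mul_assoc, hNe]; push_cast; ring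
      rw [hse]
      refine heatKernel_far_le (by positivity) ?_ hr0 (by linarith) (by linarith)
      rw [← hNe]
      gcongr
      have := Finset.mem_range.1 hk
      omega
    · refine lintegral_mono_ae ?_
      have : ∀ᵐ w ∂(volume : Measure ℂ), w ≠ x := by
        simp [ae_iff]
      filter_upwards [ae_restrict_of_ae this] with w hw
      rw [← mul_assoc]
      gcongr
      refine (sum_heatKernel_le he0 (m * j) (sub_ne_zero.2 hw.symm)).trans (le_of_eq ?_)
      rw [hNe, ENNReal.ofReal_mul (by positivity), mul_comm, he, inv_inv]
  have h5 : ∫⁻ w, ENNReal.ofReal (Real.log (1 + 1 / ‖x - w‖ ^ 2) / Real.pi)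
      ∂(volume.restrict S).withDensity (fun w => ENNReal.ofReal (m * j) * defect v C e w) =
      ∫⁻ w in S, ENNReal.ofReal (Real.log (1 + 1 / ‖x - w‖ ^ 2) / Real.pi) *
        (ENNReal.ofReal (m * j) * defect v C e w) := by
    rw [lintegral_withDensity_eq_lintegral_mul _ (by fun_prop) (by fun_prop)]
    simp only [Pi.mul_apply, mul_comm]
  rw [h5, add_assoc]
  exact h2.trans (add_le_add h3 h4)

end HeatSuper

lemma lintegral_one_add_inv_norm_lt_top (R : ℝ) :
    ∫⁻ z in Metric.ball (0 : ℂ) R, ENNReal.ofReal (1 + 1 / ‖z‖) < ⊤ := by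
  rw [← lintegral_indicator Metric.isOpen_ball.measurableSet,
    ← Complex.lintegral_comp_polarCoord_symm]
  have hm : MeasurableSet (Set.Ioo (0 : ℝ) R ×ˢ Set.Ioo (-Real.pi) Real.pi) :=
    measurableSet_Ioo.prod measurableSet_Ioo
  calc _ ≤ ∫⁻ p : ℝ × ℝ in polarCoord.target,
        (Set.Ioo (0 : ℝ) R ×ˢ Set.Ioo (-Real.pi) Real.pi).indicator
          (fun _ => ENNReal.ofReal (R + 1)) p := by
        refine setLIntegral_mono' polarCoord.open_target.measurableSet fun p hp => ?_
        rw [polarCoord_target] at hp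
        obtain ⟨hp1, hp2⟩ := hp
        have hp1 : 0 < p.1 := hp1
        have hn : ‖Complex.polarCoord.symm p‖ = p.1 := by
          simp [abs_of_pos hp1]
        by_cases hpR : p.1 < R
        · have hpm : p ∈ Set.Ioo (0 : ℝ) R ×ˢ Set.Ioo (-Real.pi) Real.pi := ⟨⟨hp1, hpR⟩, hp2⟩
          rw [Set.indicator_of_mem (by rwa [mem_ball_zero_iff, hn]), Set.indicator_of_mem hpm, hn, smul_eq_mul, ← ENNReal.ofReal_mul hp1.le]
          apply ENNReal.ofReal_le_ofReal
          rw [mul_add, mul_one_div_cancel hp1.ne']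
          linarith
        · rw [Set.indicator_of_notMem (by rwa [mem_ball_zero_iff, hn])]
          simp
    _ ≤ ∫⁻ p : ℝ × ℝ, (Set.Ioo (0 : ℝ) R ×ˢ Set.Ioo (-Real.pi) Real.pi).indicator
          (fun _ => ENNReal.ofReal (R + 1)) p := setLIntegral_le_lintegral _ _
    _ < ⊤ := by
        rw [lintegral_indicator hm, setLIntegral_const, Measure.volume_eq_prod, Measure.prod_prod]
        refine ENNReal.mul_lt_top ENNReal.ofReal_lt_top (ENNReal.mul_lt_top ?_ ?_) <;>
          simp [ENNReal.ofReal_lt_top]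

/-- Jensen's inequality for exponentials of potentials. -/
lemma exp_le_lintegral_exp {ν : Measure ℂ} {δ t K Y : ℝ} (hδ : 0 < δ) (ht : 0 < t) (hK : 0 ≤ K)
    (h0 : ν Set.univ ≠ 0) (hν : ν Set.univ ≤ ENNReal.ofReal δ) {φ : ℂ → ℝ} (hφ : Measurable φ)
    (hφ0 : ∀ w, 0 ≤ φ w)
    (hY : ENNReal.ofReal Y ≤ ENNReal.ofReal K + ∫⁻ w, ENNReal.ofReal (φ w) ∂ν) :
    ENNReal.ofReal (Real.exp (t * Y)) ≤ ENNReal.ofReal (Real.exp (t * K)) *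
      ((ν Set.univ)⁻¹ * ∫⁻ w, ENNReal.ofReal (Real.exp (t * δ * φ w)) ∂ν) := by
  have htop : ν Set.univ ≠ ⊤ := ne_top_of_le_ne_top ENNReal.ofReal_ne_top hν
  by_cases hI : ∫⁻ w, ENNReal.ofReal (Real.exp (t * δ * φ w)) ∂ν = ⊤
  · rw [hI, ENNReal.mul_top (by simpa using htop), ENNReal.mul_top (by simp [Real.exp_pos])]
    exact le_top
  have : IsFiniteMeasure ν := ⟨htop.lt_top⟩
  have : NeZero ν := ⟨fun h => h0 (by simp [h])⟩
  have hm1 : ν.real Set.univ ≤ δ := ENNReal.toReal_le_of_le_ofReal hδ.le hν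
  have hm0 : 0 < ν.real Set.univ := ENNReal.toReal_pos h0 htop
  set m := ν.real Set.univ with hm
  have hexp : Integrable (fun w => Real.exp (t * δ * φ w)) ν :=
    (lintegral_ofReal_ne_top_iff_integrable (by fun_prop) (ae_of_all _ fun _ => (Real.exp_pos _).le)).1 hI
  have hexpm : Integrable (fun w => Real.exp (t * m * φ w)) ν := by
    refine hexp.mono' (by fun_prop) (ae_of_all _ fun w => ?_)
    rw [Real.norm_eq_abs, abs_of_pos (Real.exp_pos _)]
    have := hφ0 w
    gcongr
  have hlin : Integrable (fun w => t * m * φ w) ν := by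
    refine hexpm.mono' (by fun_prop) (ae_of_all _ fun w => ?_)
    have := hφ0 w
    rw [Real.norm_eq_abs, abs_of_nonneg (by positivity)]
    linarith [Real.add_one_le_exp (t * m * φ w)]
  have hφi : Integrable φ ν := by
    have := hlin.const_mul (t * m)⁻¹
    refine this.congr (ae_of_all _ fun w => ?_)
    field_simp
  have hJ := convexOn_exp.map_average_le (μ := ν) Real.continuous_exp.continuousOn isClosed_univ
    (ae_of_all _ fun _ => Set.mem_univ _) hlin hexpm
  rw [average_eq, average_eq, integral_const_mul, ← hm] at hJ
  simp only [smul_eq_mul] at hJ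
  rw [show m⁻¹ * (t * m * ∫ w, φ w ∂ν) = t * ∫ w, φ w ∂ν by field_simp] at hJ
  have hint0 : 0 ≤ ∫ w, φ w ∂ν := integral_nonneg hφ0
  rw [← ofReal_integral_eq_lintegral_ofReal hφi (ae_of_all _ hφ0), ← ENNReal.ofReal_add hK hint0,
    ENNReal.ofReal_le_ofReal_iff (by positivity)] at hY
  rw [← ofReal_integral_eq_lintegral_ofReal hexp (ae_of_all _ fun _ => (Real.exp_pos _).le),
    ← ENNReal.ofReal_toReal htop, ← Measure.real, ← hm, ← ENNReal.ofReal_inv_of_pos hm0,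
    ← ENNReal.ofReal_mul (by positivity), ← ENNReal.ofReal_mul (by positivity)]
  apply ENNReal.ofReal_le_ofReal
  calc Real.exp (t * Y) ≤ Real.exp (t * K) * Real.exp (t * ∫ w, φ w ∂ν) := by
        rw [← Real.exp_add, ← mul_add]; gcongr
    _ ≤ Real.exp (t * K) * (m⁻¹ * ∫ w, Real.exp (t * m * φ w) ∂ν) := by gcongr
    _ ≤ _ := by
        refine mul_le_mul_of_nonneg_left (mul_le_mul_of_nonneg_left ?_ (by positivity))
          (Real.exp_pos _).le
        refine integral_mono hexpm hexp fun w => ?_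
        have := hφ0 w
        dsimp only
        gcongr

namespace HeatSuper
variable {v : ℂ → ℝ≥0∞} {C : ℝ≥0}

/-- The heat regularisations of a lower semicontinuous function recover it. -/
lemma le_liminf_heatOp (hv : LowerSemicontinuous v) {e : ℕ → ℝ} (he0 : ∀ j, 0 < e j)
    (he : Tendsto e atTop (𝓝 0)) (x : ℂ) :
    v x ≤ liminf (fun j => heatOp (e j) v x) atTop := by
  have hm := hv.measurable
  have h1 : ∀ j, heatOp (e j) v x = ∫⁻ z, heatKernel 1 z * v (x - ((√(e j) : ℝ) : ℂ) * z) := by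
    intro j
    have hs : 0 < √(e j) := Real.sqrt_pos.2 (he0 j)
    have hc : ((√(e j) : ℝ) : ℂ) ≠ 0 := by exact_mod_cast hs.ne'
    have h2 : heatOp (e j) v x = ∫⁻ z, heatKernel (e j) z * v (x - z) := by
      rw [heatOp, ← lintegral_sub_left_eq_self _ x]
      simp
    have h3 : ∫⁻ z : ℂ, heatKernel (e j) (√(e j) • z) * v (x - √(e j) • z) =
        ENNReal.ofReal |((√(e j)) ^ 2)⁻¹| * ∫⁻ z, heatKernel (e j) z * v (x - z) := by
      rw [← lintegral_map (f := fun z => heatKernel (e j) z * v (x - z)) (by fun_prop)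
        (measurable_const_smul _), Measure.map_addHaar_smul _ hs.ne', lintegral_smul_measure]
      simp
    rw [h2]
    simp only [Complex.real_smul] at h3
    rw [← ENNReal.mul_right_inj (a := ENNReal.ofReal |((√(e j)) ^ 2)⁻¹|)
      (by simp [he0 j]) (by simp), ← h3, ← lintegral_const_mul' _ _ (by simp)]
    refine lintegral_congr fun z => ?_
    rw [← mul_assoc]
    congr 1
    rw [heatKernel, heatKernel, ← ENNReal.ofReal_mul (by positivity), norm_mul, Complex.norm_real,
      Real.norm_of_nonneg hs.le, mul_pow, Real.sq_sqrt (he0 j).le, abs_of_pos (by simp [he0 j])]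
    have := (he0 j).ne'
    congr 1
    field_simp
  simp_rw [h1]
  refine le_trans ?_ (lintegral_liminf_le fun j => by fun_prop)
  calc v x = ∫⁻ z, heatKernel 1 z * v x := by
        rw [lintegral_mul_const _ (by fun_prop), lintegral_heatKernel one_pos, one_mul]
    _ ≤ _ := by
        refine lintegral_mono fun z => ?_
        refine le_of_forall_lt fun b hb => ?_
        have hcont : Tendsto (fun j => x - ((√(e j) : ℝ) : ℂ) * z) atTop (𝓝 x) := by
          have : Tendsto (fun j => ((√(e j) : ℝ) : ℂ)) atTop (𝓝 0) := by
            have h := (Complex.continuous_ofReal.comp Real.continuous_sqrt).tendsto 0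
            simp only [Function.comp, Real.sqrt_zero, Complex.ofReal_zero] at h
            exact h.comp he
          simpa using tendsto_const_nhds.sub (this.mul_const z)
        have hk0 : heatKernel 1 z ≠ 0 := by
          simp [heatKernel, Real.pi_pos, Real.exp_pos]
        have hkt : heatKernel 1 z ≠ ⊤ := ENNReal.ofReal_ne_top
        obtain ⟨b', hb', hbb'⟩ : ∃ b' < v x, b < heatKernel 1 z * b' := by
          have hvx : b / heatKernel 1 z < v x := by
            rwa [ENNReal.div_lt_iff (Or.inl hk0) (Or.inl hkt), mul_comm]
          obtain ⟨b', h1, h2⟩ := exists_between hvx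
          refine ⟨b', h2, ?_⟩
          rwa [ENNReal.div_lt_iff (Or.inl hk0) (Or.inl hkt), mul_comm] at h1
        refine lt_of_lt_of_le hbb' (le_liminf_of_le (by isBoundedDefault) ?_)
        filter_upwards [hcont.eventually (hv x b' hb')] with j hj
        gcongr

lemma lintegral_exp_heatOp_le (hv : HeatSuper v C) (x₀ : ℂ) {m : ℕ} (hm : 2 ≤ m) {t : ℝ}
    (ht : 0 < t) (hmass : massBound v C x₀ m ≤ ENNReal.ofReal (Real.pi / (2 * t))) :
    ∃ K : ℝ≥0∞, K ≠ ⊤ ∧ ∀ j : ℕ, 0 < j →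
      ∫⁻ x in Metric.ball x₀ (√(m : ℝ)⁻¹ / 2),
        ENNReal.ofReal (Real.exp (t * (heatOp ((m * j : ℝ)⁻¹) v x).toReal)) ≤ K := by
  obtain ⟨K, hK⟩ := hv.exists_potential_bound x₀ hm
  set L := ∫⁻ z in Metric.ball (0 : ℂ) 2, ENNReal.ofReal (1 + 1 / ‖z‖) with hL
  set r : ℝ := √(m : ℝ)⁻¹ / 2 with hr
  have hmi : (m : ℝ)⁻¹ ≤ 1 := inv_le_one_of_one_le₀ (by exact_mod_cast (by omega : 1 ≤ m))
  have hr1 : r ≤ 1 / 2 := by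
    have : √(m : ℝ)⁻¹ ≤ 1 := by rwa [Real.sqrt_le_one]
    linarith
  have hLt : L ≠ ⊤ := (lintegral_one_add_inv_norm_lt_top 2).ne
  have hVt : volume (Metric.ball x₀ r) ≠ ⊤ := measure_ball_lt_top.ne
  refine ⟨ENNReal.ofReal (Real.exp (t * K)) * (volume (Metric.ball x₀ r) + L),
    ENNReal.mul_ne_top ENNReal.ofReal_ne_top (ENNReal.add_ne_top.2 ⟨hVt, hLt⟩), fun j hj => ?_⟩
  obtain ⟨ν, hν1, hν2, hν3⟩ := hK j hj
  have he0 : (0 : ℝ) < (m * j : ℝ)⁻¹ := by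
    have : (0 : ℝ) < m := by positivity
    positivity
  have hY : ∀ x ∈ Metric.ball x₀ r, ENNReal.ofReal (heatOp ((m * j : ℝ)⁻¹) v x).toReal ≤
      ENNReal.ofReal K + ∫⁻ w, ENNReal.ofReal (Real.log (1 + 1 / ‖x - w‖ ^ 2) / Real.pi) ∂ν := by
    intro x hx
    rw [ENNReal.ofReal_toReal (hv.heatOp_ne_top he0 x), ENNReal.ofReal_coe_nnreal]
    exact hν3 x (by rw [← dist_eq_norm]; exact (Metric.mem_ball.1 hx).le)
  by_cases h0 : ν Set.univ = 0
  · have h0' : ν = 0 := Measure.measure_univ_eq_zero.1 h0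
    subst h0'
    calc _ ≤ ∫⁻ x in Metric.ball x₀ r, ENNReal.ofReal (Real.exp (t * K)) := by
          refine setLIntegral_mono' measurableSet_ball fun x hx => ?_
          have := hY x hx
          rw [lintegral_zero_measure, add_zero, ENNReal.ofReal_le_ofReal_iff (NNReal.coe_nonneg K)] at this
          gcongr
      _ ≤ _ := by
          rw [setLIntegral_const]
          gcongr
          exact le_self_add
  have hfin : ν Set.univ ≠ ⊤ := ne_top_of_le_ne_top ENNReal.ofReal_ne_top (hν1.trans hmass)
  have : IsFiniteMeasure ν := ⟨hfin.lt_top⟩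
  have hexp : ∀ z : ℂ, Real.exp (t * (Real.pi / (2 * t)) * (Real.log (1 + 1 / ‖z‖ ^ 2) / Real.pi)) ≤
      1 + 1 / ‖z‖ := by
    intro z
    have h1 : t * (Real.pi / (2 * t)) * (Real.log (1 + 1 / ‖z‖ ^ 2) / Real.pi) =
        Real.log √(1 + 1 / ‖z‖ ^ 2) := by
      rw [Real.log_sqrt (by positivity)]; field_simp
    rw [h1, Real.exp_log (by positivity), Real.sqrt_le_left (by positivity), add_sq, one_pow,
      div_pow, one_pow]
    have : 0 ≤ 2 * 1 * (1 / ‖z‖) := by positivity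
    linarith
  calc _ ≤ ∫⁻ x in Metric.ball x₀ r, ENNReal.ofReal (Real.exp (t * K)) *
        ((ν Set.univ)⁻¹ * ∫⁻ w, ENNReal.ofReal (1 + 1 / ‖x - w‖) ∂ν) := by
        refine setLIntegral_mono' measurableSet_ball fun x hx => ?_
        refine (exp_le_lintegral_exp (δ := Real.pi / (2 * t)) (by positivity) ht (NNReal.coe_nonneg K) h0
          (hν1.trans hmass) (by fun_prop) (fun w => ?_) (hY x hx)).trans ?_
        · have : 0 ≤ Real.log (1 + 1 / ‖x - w‖ ^ 2) :=
            Real.log_nonneg (by have : 0 ≤ 1 / ‖x - w‖ ^ 2 := by positivity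
                                linarith)
          positivity
        · refine mul_le_mul_right (mul_le_mul_right (lintegral_mono fun w => ?_) _) _
          exact ENNReal.ofReal_le_ofReal (hexp _)
    _ = ENNReal.ofReal (Real.exp (t * K)) * ((ν Set.univ)⁻¹ *
          ∫⁻ w, (∫⁻ x in Metric.ball x₀ r, ENNReal.ofReal (1 + 1 / ‖x - w‖)) ∂ν) := by
        have : Measurable fun x => ∫⁻ w, ENNReal.ofReal (1 + 1 / ‖x - w‖) ∂ν :=
          Measurable.lintegral_prod_right' (f := fun q : ℂ × ℂ => ENNReal.ofReal (1 + 1 / ‖q.1 - q.2‖))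
            (by fun_prop)
        rw [lintegral_const_mul _ (by fun_prop), lintegral_const_mul _ (by fun_prop),
          lintegral_lintegral_swap (by fun_prop)]
    _ ≤ ENNReal.ofReal (Real.exp (t * K)) * ((ν Set.univ)⁻¹ * ∫⁻ w, L ∂ν) := by
        refine mul_le_mul_right (mul_le_mul_right (lintegral_mono_ae ?_) _) _
        filter_upwards [hν2] with w hw
        have hw1 : ‖x₀ - w‖ ≤ 1 := by
          rw [← abs_of_nonneg (norm_nonneg (x₀ - w)), ← sq_le_one_iff_abs_le_one]
          exact hw.trans hmi
        rw [hL, ← lintegral_indicator measurableSet_ball, ← lintegral_indicator measurableSet_ball,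
          ← lintegral_sub_right_eq_self ((Metric.ball (0 : ℂ) 2).indicator _) w]
        refine lintegral_mono fun x => ?_
        by_cases hx : x ∈ Metric.ball x₀ r
        · rw [Set.indicator_of_mem hx, Set.indicator_of_mem]
          rw [mem_ball_zero_iff]
          rw [Metric.mem_ball, dist_eq_norm] at hx
          have := norm_add_le (x - x₀) (x₀ - w)
          rw [sub_add_sub_cancel] at this
          linarith
        · rw [Set.indicator_of_notMem hx]; simp
    _ ≤ _ := by
        rw [lintegral_const, mul_comm L, ← mul_assoc (ν Set.univ)⁻¹, ENNReal.inv_mul_cancel h0 hfin,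
          one_mul]
        gcongr
        exact le_add_self

/-- Exponential decay of superlevel sets near points of small mass. -/
lemma exists_superlevel_decay (hv : HeatSuper v C) (x₀ : ℂ) {m : ℕ} (hm : 2 ≤ m) {t : ℝ}
    (ht : 0 < t) (hmass : massBound v C x₀ m ≤ ENNReal.ofReal (Real.pi / (2 * t))) :
    ∃ K : ℝ≥0∞, K ≠ ⊤ ∧ ∀ M : ℝ,
      volume {x ∈ Metric.ball x₀ (√(m : ℝ)⁻¹ / 2) | ENNReal.ofReal M < v x} ≤
        K * ENNReal.ofReal (Real.exp (-(t * M))) := by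
  obtain ⟨K, hKt, hK⟩ := hv.lintegral_exp_heatOp_le x₀ hm ht hmass
  refine ⟨K, hKt, fun M => ?_⟩
  set B := Metric.ball x₀ (√(m : ℝ)⁻¹ / 2) with hB
  set A : Set ℂ := {x ∈ B | ENNReal.ofReal M < v x} with hA
  have hvm := hv.meas
  have hAm : MeasurableSet A :=
    measurableSet_ball.inter (measurableSet_lt measurable_const hvm)
  have hm0 : (0 : ℝ) < m := by positivity
  set e : ℕ → ℝ := fun j => (m * (j + 1 : ℕ) : ℝ)⁻¹ with he
  have he0 : ∀ j, 0 < e j := fun j => by positivity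
  have hlim : Tendsto e atTop (𝓝 0) := by
    apply Tendsto.inv_tendsto_atTop
    apply Tendsto.const_mul_atTop hm0
    exact (tendsto_natCast_atTop_atTop (R := ℝ)).comp (tendsto_add_atTop_nat 1)
  have h1 : volume A * ENNReal.ofReal (Real.exp (t * M)) ≤ K := by
    calc volume A * ENNReal.ofReal (Real.exp (t * M))
        = ∫⁻ x in A, ENNReal.ofReal (Real.exp (t * M)) := by rw [setLIntegral_const, mul_comm]
      _ ≤ ∫⁻ x in A, liminf (fun j => ENNReal.ofReal (Real.exp (t * (heatOp (e j) v x).toReal)))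
            atTop := by
          refine setLIntegral_mono' hAm fun x hx => ?_
          have h2 := hx.2.trans_le (le_liminf_heatOp hv.lsc he0 hlim x)
          refine le_liminf_of_le (by isBoundedDefault) ?_
          filter_upwards [eventually_lt_of_lt_liminf h2] with j hj
          gcongr
          exact (ENNReal.ofReal_le_iff_le_toReal (hv.heatOp_ne_top (he0 j) x)).1 hj.le
      _ ≤ ∫⁻ x in B, liminf (fun j => ENNReal.ofReal (Real.exp (t * (heatOp (e j) v x).toReal)))
            atTop := lintegral_mono_set fun x hx => hx.1
      _ ≤ liminf (fun j => ∫⁻ x in B, ENNReal.ofReal (Real.exp (t * (heatOp (e j) v x).toReal)))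
            atTop := lintegral_liminf_le fun j => by fun_prop
      _ ≤ K := liminf_le_of_frequently_le' (Frequently.of_forall fun j => hK (j + 1) j.succ_pos)
  calc volume A = volume A * ENNReal.ofReal (Real.exp (t * M)) *
        ENNReal.ofReal (Real.exp (-(t * M))) := by
        rw [mul_assoc, ← ENNReal.ofReal_mul (Real.exp_pos _).le, ← Real.exp_add]; simp
    _ ≤ _ := by gcongr

end HeatSuper

/-- A one-dimensional integrable majorant of the logarithmic kernel. -/
def logMajorant (t : ℝ) : ℝ≥0∞ :=
  ENNReal.ofReal (1 + 2 * |Real.log t|) + Set.indicator {0} (fun _ => ⊤) t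

@[fun_prop]
lemma measurable_logMajorant : Measurable logMajorant := by
  unfold logMajorant
  exact (by fun_prop : Measurable fun t : ℝ => ENNReal.ofReal (1 + 2 * |Real.log t|)).add
    (measurable_const.indicator (measurableSet_singleton 0))

lemma lintegral_logMajorant_lt_top :
    ∫⁻ t in Set.Ioc (-1 : ℝ) 1, logMajorant t < ⊤ := by
  unfold logMajorant
  rw [lintegral_add_left (by fun_prop)]
  refine ENNReal.add_lt_top.2 ⟨?_, ?_⟩
  · have h1 : IntegrableOn (fun t => 1 + 2 * |Real.log t|) (Set.Ioc (-1 : ℝ) 1) := by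
      have h := (intervalIntegral.intervalIntegrable_log' (a := -1) (b := 1)).abs
      rw [intervalIntegrable_iff_integrableOn_Ioc_of_le (by norm_num)] at h
      exact (integrableOn_const (by simp)).add (h.const_mul 2)
    exact h1.lintegral_lt_top
  · have : (Set.indicator {0} (fun _ => ⊤) : ℝ → ℝ≥0∞) =ᵐ[volume.restrict (Set.Ioc (-1 : ℝ) 1)] 0 := by
      have h0 : ∀ᵐ t : ℝ ∂(volume.restrict (Set.Ioc (-1 : ℝ) 1)), t ≠ 0 :=
        ae_restrict_of_ae (Measure.ae_ne volume 0)
      filter_upwards [h0] with t ht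
      simp [ht]
    rw [lintegral_congr_ae this]
    simp

lemma log_le_logMajorant {t d : ℝ} (ht : |t| ≤ 1) (hd : |t| ≤ d) :
    ENNReal.ofReal (Real.log (1 + 1 / d ^ 2) / Real.pi) ≤ logMajorant t := by
  by_cases h0 : t = 0
  · simp [logMajorant, h0]
  refine le_add_right (ENNReal.ofReal_le_ofReal ?_)
  have ht0 : 0 < |t| := abs_pos.2 h0
  have hd0 : 0 < d := ht0.trans_le hd
  have h1 : 0 ≤ Real.log (1 + 1 / d ^ 2) :=
    Real.log_nonneg (le_add_of_nonneg_right (by positivity))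
  calc Real.log (1 + 1 / d ^ 2) / Real.pi ≤ Real.log (1 + 1 / d ^ 2) :=
        div_le_self h1 (by linarith [Real.pi_gt_three])
    _ ≤ Real.log (1 + 1 / |t| ^ 2) := by gcongr
    _ = Real.log (1 + |t| ^ 2) - 2 * Real.log t := by
        rw [← Real.log_abs t, show (2 : ℝ) * Real.log |t| = Real.log (|t| ^ 2) by simp,
          ← Real.log_div (by positivity) (by positivity)]
        congr 1
        field_simp
        ring
    _ ≤ 1 + 2 * |Real.log t| := by
        have h2 := Real.log_le_sub_one_of_pos (show 0 < 1 + |t| ^ 2 by positivity)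
        have h3 : |t| ^ 2 ≤ 1 := pow_le_one₀ ht0.le ht
        linarith [neg_abs_le (Real.log t)]

namespace HeatSuper
variable {v : ℂ → ℝ≥0∞} {C : ℝ≥0}

/-- The polar set of a heat-superharmonic function misses arbitrarily small circles. -/
lemma exists_circle_ne_top (hv : HeatSuper v C) (x₀ : ℂ) {r₀ : ℝ} (hr₀ : 0 < r₀) :
    ∃ r, 0 < r ∧ r < r₀ ∧ ∀ y, ‖y - x₀‖ = r → v y ≠ ⊤ := by
  by_contra! hcon
  choose! x hx hxt using hcon
  obtain ⟨K, hK⟩ := hv.exists_potential_bound x₀ (m := 2) le_rfl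
  choose! ν hν1 hν2 hν3 using hK
  set ρ : ℝ := √((2 : ℕ) : ℝ)⁻¹ / 2 with hρ
  have hρ0 : 0 < ρ := by positivity
  have hρ1 : ρ ≤ 1 := by
    have : √((2 : ℕ) : ℝ)⁻¹ ≤ 1 := by rw [Real.sqrt_le_one]; norm_num
    linarith
  set R := min r₀ ρ with hR
  have hR0 : 0 < R := lt_min hr₀ hρ0
  have hR1 : R ≤ 1 := (min_le_right _ _).trans hρ1
  set e : ℕ → ℝ := fun j => (((2 : ℕ) : ℝ) * (j + 1 : ℕ) : ℝ)⁻¹ with he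
  have he0 : ∀ j, 0 < e j := fun j => by positivity
  have hlim : Tendsto e atTop (𝓝 0) := by
    apply Tendsto.inv_tendsto_atTop
    apply Tendsto.const_mul_atTop (by norm_num)
    exact (tendsto_natCast_atTop_atTop (R := ℝ)).comp (tendsto_add_atTop_nat 1)
  set F : ℕ → ℝ → ℝ≥0∞ := fun j r => K + ∫⁻ w, logMajorant (r - ‖w - x₀‖) ∂(ν (j + 1)) with hF
  have hfin : ∀ j, IsFiniteMeasure (ν (j + 1)) := fun j =>
    ⟨(hν1 (j + 1) j.succ_pos).trans_lt (hv.massBound_ne_top x₀ le_rfl).lt_top⟩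
  have hs1 : ∀ j, ∀ᵐ w ∂(ν (j + 1)), ‖w - x₀‖ ≤ 1 := by
    intro j
    filter_upwards [hν2 (j + 1) j.succ_pos] with w hw
    rw [norm_sub_rev, ← abs_of_nonneg (norm_nonneg (x₀ - w)), ← sq_le_one_iff_abs_le_one]
    exact hw.trans (by norm_num)
  have hFm : ∀ j, Measurable (F j) := fun j => by
    refine Measurable.add (M := ℝ≥0∞) measurable_const ?_
    exact Measurable.lintegral_prod_right'
      (f := fun q : ℝ × ℂ => logMajorant (q.1 - ‖q.2 - x₀‖)) (by fun_prop)
  have hFl : ∀ j, ∀ r ∈ Set.Ioo 0 R, heatOp (e j) v (x r) ≤ F j r := by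
    intro j r hr
    have hxr := hx r hr.1 (hr.2.trans_le (min_le_left _ _))
    refine (hν3 (j + 1) j.succ_pos (x r) (hxr.le.trans (hr.2.le.trans (min_le_right _ _)))).trans ?_
    refine add_le_add le_rfl (lintegral_mono_ae ?_)
    filter_upwards [hs1 j] with w hw
    refine log_le_logMajorant ?_ ?_
    · rw [abs_le]
      constructor <;> linarith [norm_nonneg (w - x₀), hr.1, hr.2]
    · have := abs_norm_sub_norm_le (x r - x₀) (w - x₀)
      rwa [hxr, sub_sub_sub_cancel_right] at this
  set L := ∫⁻ t in Set.Ioc (-1 : ℝ) 1, logMajorant t with hL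
  have hLt : L ≠ ⊤ := lintegral_logMajorant_lt_top.ne
  have hFint : ∀ j, ∫⁻ r in Set.Ioo 0 R, F j r ≤
      K * ENNReal.ofReal R + L * massBound v C x₀ 2 := by
    intro j
    rw [hF, lintegral_add_left measurable_const]
    refine add_le_add ?_ ?_
    · rw [setLIntegral_const, Real.volume_Ioo, sub_zero]
    · rw [lintegral_lintegral_swap (by fun_prop)]
      calc _ ≤ ∫⁻ w, L ∂(ν (j + 1)) := by
            refine lintegral_mono_ae ?_
            filter_upwards [hs1 j] with w hw
            rw [hL, ← lintegral_indicator measurableSet_Ioo, ← lintegral_indicator measurableSet_Ioc,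
              ← lintegral_sub_right_eq_self ((Set.Ioc (-1 : ℝ) 1).indicator _) ‖w - x₀‖]
            refine lintegral_mono fun r => ?_
            by_cases hr : r ∈ Set.Ioo 0 R
            · rw [Set.indicator_of_mem hr, Set.indicator_of_mem]
              constructor <;> linarith [norm_nonneg (w - x₀), hr.1, hr.2]
            · rw [Set.indicator_of_notMem hr]; simp
        _ ≤ _ := by
            rw [lintegral_const]
            gcongr
            exact hν1 (j + 1) j.succ_pos
  have h1 : ∫⁻ r in Set.Ioo 0 R, (⊤ : ℝ≥0∞) ≤ K * ENNReal.ofReal R + L * massBound v C x₀ 2 := by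
    calc _ ≤ ∫⁻ r in Set.Ioo 0 R, liminf (fun j => F j r) atTop := by
          refine setLIntegral_mono' measurableSet_Ioo fun r hr => ?_
          rw [← hxt r hr.1 (hr.2.trans_le (min_le_left _ _))]
          refine (le_liminf_heatOp hv.lsc he0 hlim _).trans ?_
          exact liminf_le_liminf (Eventually.of_forall fun j => hFl j r hr)
      _ ≤ liminf (fun j => ∫⁻ r in Set.Ioo 0 R, F j r) atTop := lintegral_liminf_le hFm
      _ ≤ _ := liminf_le_of_frequently_le' (Frequently.of_forall hFint)
  rw [setLIntegral_const, Real.volume_Ioo, sub_zero, ENNReal.top_mul (by simpa using hR0),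
    top_le_iff] at h1
  exact ENNReal.add_ne_top.2 ⟨ENNReal.mul_ne_top ENNReal.coe_ne_top ENNReal.ofReal_ne_top,
    ENNReal.mul_ne_top hLt (hv.massBound_ne_top x₀ le_rfl)⟩ h1

/-- Sublogarithmic growth near `x₀` forces arbitrarily small mass there. -/
lemma exists_massBound_le (hv : HeatSuper v C) (x₀ : ℂ)
    (hsmall : ∀ δ > 0, ∀ r₀ > 0, ∃ r, 0 < r ∧ r < r₀ ∧
      ∃ y, ‖y - x₀‖ = r ∧ v y ≤ ENNReal.ofReal (δ * Real.log (1 / r))) {η : ℝ} (hη : 0 < η) :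
    ∃ m : ℕ, 2 ≤ m ∧ massBound v C x₀ m ≤ ENNReal.ofReal η := by
  set E := Real.exp 1 with hE
  have hE0 : 0 < E := Real.exp_pos 1
  set B : ℝ := 2 * Real.pi * E * ((4 * E + 1) * C) / η with hB
  obtain ⟨r, hr0, hr1, y, hy, hvy⟩ := hsmall (η / (4 * Real.pi * E ^ 2)) (by positivity)
    (min (1 / 2) (Real.exp (-(B + 1)))) (by positivity)
  have hr2 : r < 1 / 2 := hr1.trans_le (min_le_left _ _)
  have hr3 : r < Real.exp (-(B + 1)) := hr1.trans_le (min_le_right _ _)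
  set L := Real.log (1 / r) with hL
  have hB0 : 0 ≤ B := by positivity
  have hLB : B + 1 < L := by
    rw [hL, one_div, Real.log_inv]
    have := Real.log_lt_log hr0 hr3
    rw [Real.log_exp] at this
    linarith
  have hL0 : 0 < L := by linarith
  set m := ⌊1 / r ^ 2⌋₊ with hm
  have hm1 : 1 / r < m := by
    have h1 := Nat.lt_floor_add_one (1 / r ^ 2)
    have hu : 2 < 1 / r := by rw [lt_div_iff₀ hr0]; linarith
    have h2 : 1 / r ^ 2 = (1 / r) ^ 2 := by field_simp
    rw [← hm, h2] at h1
    nlinarith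
  have hmr : (m : ℝ) * r ^ 2 ≤ 1 := by
    have := Nat.floor_le (a := 1 / r ^ 2) (by positivity)
    rwa [← hm, le_div_iff₀ (by positivity)] at this
  have hm2 : 2 ≤ m := by
    have hu : 2 < 1 / r := by rw [lt_div_iff₀ hr0]; linarith
    exact_mod_cast (hu.trans hm1).le
  have hm0 : (0 : ℝ) < m := by positivity
  have hlogm : L ≤ Real.log m := Real.log_le_log (by positivity) hm1.le
  refine ⟨m, hm2, ?_⟩
  have h1 : heatOp (m : ℝ)⁻¹ v x₀ ≤
      ENNReal.ofReal (2 * E * (η / (4 * Real.pi * E ^ 2) * L + 2 * C)) := by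
    calc _ ≤ _ := heatOp_le (s' := 2 * (m : ℝ)⁻¹) (by positivity) le_rfl x₀ y
      _ ≤ ENNReal.ofReal (2 * E) * (ENNReal.ofReal (η / (4 * Real.pi * E ^ 2) * L) +
            ENNReal.ofReal (2 * C)) := by
          gcongr
          · apply le_of_eq
            field_simp
          · rw [hE, norm_sub_rev, hy, Real.exp_le_exp]
            calc _ = (m : ℝ) * r ^ 2 := by field_simp
              _ ≤ 1 := hmr
          · refine (hv.super _ (by positivity) y).trans ?_
            refine add_le_add hvy (ENNReal.ofReal_le_ofReal ?_)
            have : (m : ℝ)⁻¹ ≤ 1 := inv_le_one_of_one_le₀ (by exact_mod_cast (by omega : 1 ≤ m))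
            nlinarith [NNReal.coe_nonneg C]
      _ = _ := by
          rw [← ENNReal.ofReal_add (by positivity) (by positivity),
            ← ENNReal.ofReal_mul (by positivity)]
  calc massBound v C x₀ m ≤ ENNReal.ofReal (Real.pi * E / L) *
        (ENNReal.ofReal (2 * E * (η / (4 * Real.pi * E ^ 2) * L + 2 * C)) + ENNReal.ofReal C) := by
        unfold massBound
        rw [ENNReal.ofReal_coe_nnreal]
        gcongr
    _ = ENNReal.ofReal (Real.pi * E / L *
          (2 * E * (η / (4 * Real.pi * E ^ 2) * L + 2 * C) + C)) := by
        rw [← ENNReal.ofReal_add (by positivity) (by positivity),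
          ← ENNReal.ofReal_mul (by positivity)]
    _ ≤ ENNReal.ofReal η := by
        apply ENNReal.ofReal_le_ofReal
        have h2 : Real.pi * E / L * (2 * E * (η / (4 * Real.pi * E ^ 2) * L + 2 * C) + C) =
            η / 2 + (η / 2) * (B / L) := by
          rw [hB]
          field_simp
          ring
        rw [h2]
        have h3 : B / L ≤ 1 := by rw [div_le_one hL0]; linarith
        nlinarith

end HeatSuper

/-- Nonnegative functions on the plane whose logarithm is subharmonic. -/
structure LogSub (g : ℂ → ℝ) (D : ℝ≥0) : Prop where
  nonneg : ∀ z, 0 ≤ g z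
  usc : UpperSemicontinuous g
  log_le : ∀ z, Real.log (g z) ≤ D * (1 + ‖z‖ ^ 2)
  ae_ne : ∀ x w, g x ≠ 0 → ∀ᵐ θ : ℝ ∂(volume.restrict (Set.Ioc 0 (2 * Real.pi))),
    g (x + Complex.exp (θ * Complex.I) * w) ≠ 0
  mean : ∀ x w, g x ≠ 0 → ∀ c : ℝ, Real.log (g x) ≤ (1 / (2 * Real.pi)) *
    ∫ θ in (0 : ℝ)..(2 * Real.pi), max (Real.log (g (x + Complex.exp (θ * Complex.I) * w))) c

section Homogeneous
variable {n : ℕ} {h : (Fin n → ℂ) → ℝ}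

lemma AbsHomog.exists_le_norm (husc : UpperSemicontinuous h) (hhom : AbsHomog h) :
    ∃ A : ℝ, 0 < A ∧ ∀ z, h z ≤ A * ‖z‖ := by
  obtain ⟨A, hA⟩ := (husc.upperSemicontinuousOn (Metric.sphere 0 1)).bddAbove_of_isCompact
    (isCompact_sphere _ _)
  refine ⟨max A 1, by positivity, fun z => ?_⟩
  by_cases hz : z = 0
  · have := hhom 0 0
    simp only [smul_zero, norm_zero, zero_mul] at this
    simp [hz, this]
  have hz' : 0 < ‖z‖ := norm_pos_iff.2 hz
  have h1 : h ((‖z‖ : ℂ)⁻¹ • z) ≤ A := by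
    refine hA ⟨_, ?_, rfl⟩
    rw [mem_sphere_zero_iff_norm, norm_smul, norm_inv, Complex.norm_real, norm_norm,
      inv_mul_cancel₀ hz'.ne']
  rw [hhom, norm_inv, Complex.norm_real, norm_norm, inv_mul_le_iff₀ hz'] at h1
  nlinarith [le_max_left A 1]

/-- `h` vanishes at most on a null set of any circle around a point where it does not vanish. -/
lemma LogPSH.ae_circle_ne (hpos : ∀ z, 0 ≤ h z) (husc : UpperSemicontinuous h) (hhom : AbsHomog h)
    (hpsh : LogPSH h) {a : Fin n → ℂ} (b : Fin n → ℂ) {r : ℝ} (hr : 0 < r) (ha : h a ≠ 0) :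
    ∀ᵐ θ : ℝ ∂(volume.restrict (Set.Ioc 0 (2 * Real.pi))),
      h (a + ((r : ℂ) * Complex.exp (θ * Complex.I)) • b) ≠ 0 := by
  obtain ⟨A, hA0, hA⟩ := hhom.exists_le_norm husc
  set p : ℝ → Fin n → ℂ := fun θ => a + ((r : ℂ) * Complex.exp (θ * Complex.I)) • b with hp
  have hpc : Continuous p := by fun_prop
  have hm : Measurable fun θ => h (p θ) := husc.measurable.comp hpc.measurable
  set Z : Set ℝ := {θ | h (p θ) = 0} with hZ
  have hZm : MeasurableSet Z := hm (measurableSet_singleton 0)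
  set μ := volume.restrict (Set.Ioc 0 (2 * Real.pi)) with hμ
  have hμu : μ.real Set.univ = 2 * Real.pi := by
    simp [hμ, Measure.real, Real.pi_pos.le]
  set B : ℝ := max 1 (A * (‖a‖ + r * ‖b‖)) with hB
  have hB1 : 1 ≤ B := le_max_left _ _
  have hpB : ∀ θ, h (p θ) ≤ B := by
    intro θ
    refine (hA _).trans (le_max_of_le_right ?_)
    gcongr
    refine (norm_add_le _ _).trans ?_
    rw [norm_smul, norm_mul, Complex.norm_exp_ofReal_mul_I, Complex.norm_real, mul_one,
      Real.norm_of_nonneg hr.le]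
  have key : ∀ t : ℝ, 1 ≤ t → Real.log t + Real.log (h a) ≤
      (1 / (2 * Real.pi)) * ((2 * Real.pi - μ.real Z) * (Real.log t + Real.log B)) := by
    intro t ht
    have ht0 : 0 < t := by linarith
    have hth : ∀ z, h ((t : ℂ) • z) = t * h z := fun z => by
      rw [hhom, Complex.norm_real, Real.norm_of_nonneg ht0.le]
    have h1 := hpsh ((t : ℂ) • a) ((t : ℂ) • b) r hr (by rw [hth]; positivity) 0
    rw [hth, Real.log_mul ht0.ne' ha, intervalIntegral.integral_of_le (by positivity)] at h1
    refine h1.trans (mul_le_mul_of_nonneg_left ?_ (by positivity))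
    have hc : (2 * Real.pi - μ.real Z) * (Real.log t + Real.log B) =
        ∫ θ, Zᶜ.indicator (fun _ => Real.log t + Real.log B) θ ∂μ := by
      rw [integral_indicator_const _ hZm.compl, measureReal_compl hZm, hμu, smul_eq_mul]
    rw [hc]
    refine integral_mono_of_nonneg (ae_of_all _ fun θ => le_max_right _ _)
      ((integrable_const _).indicator hZm.compl) (ae_of_all _ fun θ => ?_)
    have he : (t : ℂ) • a + ((r : ℂ) * Complex.exp (θ * Complex.I)) • (t : ℂ) • b = (t : ℂ) • p θ := by
      rw [hp, smul_add, smul_comm]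
    dsimp only
    rw [he, hth]
    by_cases hθ : h (p θ) = 0
    · rw [Set.indicator_of_notMem (by simpa [hZ] using hθ), hθ]
      simp
    · rw [Set.indicator_of_mem (by simpa [hZ] using hθ)]
      have h2 := Real.log_nonneg ht
      have h3 := Real.log_nonneg hB1
      refine max_le ?_ (by linarith)
      rw [Real.log_mul ht0.ne' hθ]
      gcongr
      · exact (hpos _).lt_of_ne' hθ
      · exact hpB θ
  have hmu0 : μ.real Z = 0 := by
    by_contra hne
    have hq : 0 < μ.real Z := lt_of_le_of_ne measureReal_nonneg (Ne.symm hne)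
    have hpi := Real.pi_pos
    have hlB := Real.log_nonneg hB1
    set N := (2 * Real.pi * (|Real.log (h a)| + Real.log B) + 1) / μ.real Z with hN
    have hN0 : 0 ≤ N := by positivity
    have h1 := key (Real.exp N) (Real.one_le_exp hN0)
    rw [Real.log_exp, one_div, inv_mul_eq_div, le_div_iff₀ (by positivity)] at h1
    have h2 : N * μ.real Z = 2 * Real.pi * (|Real.log (h a)| + Real.log B) + 1 := by
      rw [hN]; field_simp
    have h3 : 0 ≤ μ.real Z * Real.log B := by positivity
    have h4 : -(2 * Real.pi * |Real.log (h a)|) ≤ 2 * Real.pi * Real.log (h a) := by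
      nlinarith [neg_abs_le (Real.log (h a))]
    linarith
  have hmu : μ Z = 0 := (measureReal_eq_zero_iff (by finiteness)).1 hmu0
  exact measure_eq_zero_iff_ae_notMem.1 hmu

lemma LogPSH.exists_circle_ne (hpos : ∀ z, 0 ≤ h z) (husc : UpperSemicontinuous h)
    (hhom : AbsHomog h) (hpsh : LogPSH h) {a : Fin n → ℂ} (b : Fin n → ℂ) {r : ℝ} (hr : 0 < r)
    (ha : h a ≠ 0) : ∃ ζ : ℂ, ‖ζ‖ = r ∧ h (a + ζ • b) ≠ 0 := by
  have h1 := hpsh.ae_circle_ne hpos husc hhom b hr ha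
  have : (ae (volume.restrict (Set.Ioc 0 (2 * Real.pi)))).NeBot := by
    rw [ae_neBot, Ne, Measure.restrict_eq_zero]
    simp [Real.pi_pos]
  obtain ⟨θ, hθ⟩ := h1.exists
  refine ⟨_, ?_, hθ⟩
  rw [norm_mul, Complex.norm_exp_ofReal_mul_I, Complex.norm_real, mul_one,
      Real.norm_of_nonneg hr.le]

lemma LogPSH.exists_line_ne (hpos : ∀ z, 0 ≤ h z) (husc : UpperSemicontinuous h)
    (hhom : AbsHomog h) (hpsh : LogPSH h) {v e : Fin n → ℂ} {α β : ℂ}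
    (hne : h (α • v + β • e) ≠ 0) : ∃ ζ : ℂ, h (v + ζ • e) ≠ 0 := by
  obtain ⟨ζ, hζ, h1⟩ := hpsh.exists_circle_ne hpos husc hhom v (r := ‖α‖ + 1) (by positivity) hne
  have hα : α + ζ ≠ 0 := by
    intro h0
    rw [eq_neg_of_add_eq_zero_right h0, norm_neg] at hζ
    linarith
  refine ⟨(α + ζ)⁻¹ * β, fun h0 => h1 ?_⟩
  have : α • v + β • e + ζ • v = (α + ζ) • (v + ((α + ζ)⁻¹ * β) • e) := by
    rw [smul_add, smul_smul, mul_inv_cancel_left₀ hα, add_smul]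
    abel
  rw [this, hhom, h0, mul_zero]

lemma LogPSH.logSub (hpos : ∀ z, 0 ≤ h z) (husc : UpperSemicontinuous h) (hhom : AbsHomog h)
    (hpsh : LogPSH h) (a b : Fin n → ℂ) : ∃ D : ℝ≥0, LogSub (fun ζ => h (a + ζ • b)) D := by
  obtain ⟨A, hA0, hA⟩ := hhom.exists_le_norm husc
  have he : ∀ (x w : ℂ) (θ : ℝ), a + (x + Complex.exp (θ * Complex.I) * w) • b =
      a + x • b + (((1 : ℝ) : ℂ) * Complex.exp (θ * Complex.I)) • w • b := by
    intro x w θ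
    rw [add_smul, smul_smul, add_assoc, Complex.ofReal_one, one_mul]
  refine ⟨NNReal.mk (A * (‖a‖ + ‖b‖)) (by positivity), fun z => hpos _, husc.comp (by fun_prop), fun z => ?_,
    fun x w hx => ?_, fun x w hx c => ?_⟩
  · rw [NNReal.coe_mk]
    refine ((Real.log_le_self (hpos _)).trans (hA _)).trans ?_
    have h1 : ‖a + z • b‖ ≤ ‖a‖ + ‖z‖ * ‖b‖ := (norm_add_le _ _).trans (by rw [norm_smul])
    have h2 : ‖z‖ ≤ 1 + ‖z‖ ^ 2 := by nlinarith [sq_nonneg (‖z‖ - 1)]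
    have h3 : ‖z‖ * ‖b‖ ≤ (1 + ‖z‖ ^ 2) * ‖b‖ := by gcongr
    have h4 : ‖a‖ ≤ ‖a‖ * (1 + ‖z‖ ^ 2) := by nlinarith [norm_nonneg a, sq_nonneg ‖z‖]
    rw [mul_assoc]
    gcongr
    linarith
  · simp_rw [he]
    exact hpsh.ae_circle_ne hpos husc hhom _ one_pos hx
  · simp_rw [he]
    exact hpsh _ _ 1 one_pos hx c

end Homogeneous

lemma norm_add_exp_mul_sq (x w : ℂ) (θ : ℝ) :
    ‖x + Complex.exp (θ * Complex.I) * w‖ ^ 2 = ‖x‖ ^ 2 + ‖w‖ ^ 2 +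
      (2 * (x.re * w.re + x.im * w.im) * Real.cos θ + 2 * (x.im * w.re - x.re * w.im) * Real.sin θ) := by
  rw [Complex.exp_mul_I, ← Complex.ofReal_cos, ← Complex.ofReal_sin]
  simp only [Complex.sq_norm, Complex.normSq_apply, Complex.add_re, Complex.add_im, Complex.mul_re,
    Complex.mul_im, Complex.ofReal_re, Complex.ofReal_im, Complex.I_re, Complex.I_im]
  linear_combination (w.re ^ 2 + w.im ^ 2) * Real.sin_sq_add_cos_sq θ

lemma integral_norm_add_exp_mul_sq (x w : ℂ) :
    ∫ θ in (0 : ℝ)..(2 * Real.pi), ‖x + Complex.exp (θ * Complex.I) * w‖ ^ 2 =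
      2 * Real.pi * (‖x‖ ^ 2 + ‖w‖ ^ 2) := by
  simp_rw [norm_add_exp_mul_sq]
  have hc : ∀ f : ℝ → ℝ, Continuous f → IntervalIntegrable f volume 0 (2 * Real.pi) :=
    fun f hf => hf.intervalIntegrable _ _
  rw [intervalIntegral.integral_add (hc _ (by fun_prop)) (hc _ (by fun_prop)),
    intervalIntegral.integral_add (f := fun θ => _ * Real.cos θ) (hc _ (by fun_prop))
      (hc _ (by fun_prop)), intervalIntegral.integral_const_mul, intervalIntegral.integral_const_mul, integral_cos,
    integral_sin, intervalIntegral.integral_const]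
  simp

/-- The potential `-log g`, normalised to be nonnegative. -/
def logPot (g : ℂ → ℝ) (D : ℝ≥0) (ζ : ℂ) : ℝ≥0∞ :=
  if g ζ = 0 then ⊤ else ENNReal.ofReal (D * (1 + ‖ζ‖ ^ 2) - Real.log (g ζ))

namespace LogSub
variable {g : ℂ → ℝ} {D : ℝ≥0}

lemma lt_logPot_iff (hg : LogSub g D) {c : ℝ} (hc : 0 ≤ c) (ζ : ℂ) :
    ENNReal.ofReal c < logPot g D ζ ↔ g ζ < Real.exp (D * (1 + ‖ζ‖ ^ 2) - c) := by
  unfold logPot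
  split_ifs with h0
  · simp [h0, Real.exp_pos]
  · rw [ENNReal.ofReal_lt_ofReal_iff_of_nonneg hc,
      ← Real.log_lt_iff_lt_exp ((hg.nonneg ζ).lt_of_ne' h0)]
    constructor <;> intro h <;> linarith

lemma lowerSemicontinuous_logPot (hg : LogSub g D) : LowerSemicontinuous (logPot g D) := by
  intro x c hc
  have hct : c ≠ ⊤ := (hc.trans_le le_top).ne
  rw [← ENNReal.ofReal_toReal hct] at hc ⊢
  simp_rw [hg.lt_logPot_iff ENNReal.toReal_nonneg] at hc ⊢
  have hu : UpperSemicontinuous fun ζ => g ζ + -Real.exp (D * (1 + ‖ζ‖ ^ 2) - c.toReal) :=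
    hg.usc.add (Continuous.upperSemicontinuous (by fun_prop))
  filter_upwards [hu x 0 (by linarith)] with y hy
  linarith

lemma measurable_logPot (hg : LogSub g D) : Measurable (logPot g D) :=
  hg.lowerSemicontinuous_logPot.measurable

lemma lintegral_circle_logPot_le (hg : LogSub g D) (x w : ℂ) :
    ∫⁻ θ in Set.Ioc (0 : ℝ) (2 * Real.pi), logPot g D (x + Complex.exp (θ * Complex.I) * w) ≤
      ENNReal.ofReal (2 * Real.pi) * (logPot g D x + ENNReal.ofReal (D * ‖w‖ ^ 2)) := by
  by_cases hx : g x = 0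
  · rw [logPot, if_pos hx, top_add, ENNReal.mul_top (by simp [Real.pi_pos])]
    exact le_top
  set p : ℝ → ℂ := fun θ => x + Complex.exp (θ * Complex.I) * w with hp
  have hpc : Continuous p := by fun_prop
  have hgm : Measurable g := hg.usc.measurable
  set b : ℝ → ℝ := fun θ => D * (1 + ‖p θ‖ ^ 2) with hb
  have hbc : Continuous b := by fun_prop
  have hb0 : ∀ θ, 0 ≤ b θ := fun θ => by positivity
  have hbi : IntegrableOn b (Set.Ioc 0 (2 * Real.pi)) :=
    (hbc.integrableOn_Icc).mono_set Set.Ioc_subset_Icc_self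
  set B := D * (1 + ‖x‖ ^ 2) + D * ‖w‖ ^ 2 with hB
  have hbint : ∫ θ in Set.Ioc 0 (2 * Real.pi), b θ = 2 * Real.pi * B := by
    rw [← intervalIntegral.integral_of_le (by positivity), hb, intervalIntegral.integral_const_mul,
      intervalIntegral.integral_add (by simp) ((Continuous.intervalIntegrable (by fun_prop) _ _)),
      integral_norm_add_exp_mul_sq]
    simp only [intervalIntegral.integral_const, smul_eq_mul]
    ring
  set f : ℕ → ℝ → ℝ≥0∞ := fun k θ => ENNReal.ofReal (b θ - max (Real.log (g (p θ))) (-(k : ℝ))) with hf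
  have hfm : ∀ k, Measurable (f k) := fun k => by
    have := hgm.comp hpc.measurable
    have hl : Measurable fun θ => Real.log (g (p θ)) := Real.measurable_log.comp this
    fun_prop
  have h1 : ∀ k, ∫⁻ θ in Set.Ioc 0 (2 * Real.pi), f k θ ≤
      ENNReal.ofReal (2 * Real.pi) * (logPot g D x + ENNReal.ofReal (D * ‖w‖ ^ 2)) := by
    intro k
    have hl : Measurable fun θ => max (Real.log (g (p θ))) (-(k : ℝ)) :=
      (Real.measurable_log.comp (hgm.comp hpc.measurable)).max measurable_const
    have hle : ∀ θ, max (Real.log (g (p θ))) (-(k : ℝ)) ≤ b θ := fun θ =>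
      max_le (hg.log_le _) (by have := hb0 θ; have : (0 : ℝ) ≤ k := k.cast_nonneg; linarith)
    have hmi : IntegrableOn (fun θ => max (Real.log (g (p θ))) (-(k : ℝ)))
        (Set.Ioc 0 (2 * Real.pi)) := by
      refine (hbi.add (integrableOn_const (C := (k : ℝ)) measure_Ioc_lt_top.ne)).mono' hl.aestronglyMeasurable
        (ae_of_all _ fun θ => ?_)
      rw [Real.norm_eq_abs, abs_le]
      have h2 := le_max_right (Real.log (g (p θ))) (-(k : ℝ))
      have h3 := hle θ
      have h4 := hb0 θ
      have : (0 : ℝ) ≤ k := k.cast_nonneg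
      simp only [Pi.add_apply]
      constructor <;> linarith
    have hsub : IntegrableOn (fun θ => b θ - max (Real.log (g (p θ))) (-(k : ℝ)))
        (Set.Ioc 0 (2 * Real.pi)) := hbi.sub hmi
    simp only [hf]
    rw [← ofReal_integral_eq_lintegral_ofReal hsub
      (ae_of_all _ fun θ => sub_nonneg.2 (hle θ)), logPot, if_neg hx,
      ← ENNReal.ofReal_add (by linarith [hg.log_le x]) (by positivity),
      ← ENNReal.ofReal_mul (by positivity)]
    apply ENNReal.ofReal_le_ofReal
    have h2 := hg.mean x w hx (-(k : ℝ))
    rw [intervalIntegral.integral_of_le (by positivity), one_div, inv_mul_eq_div,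
      le_div_iff₀ (by positivity)] at h2
    rw [show (∫ θ in Set.Ioc 0 (2 * Real.pi), (b θ - max (Real.log (g (p θ))) (-(k : ℝ)))) =
      (∫ θ in Set.Ioc 0 (2 * Real.pi), b θ) -
      ∫ θ in Set.Ioc 0 (2 * Real.pi), max (Real.log (g (p θ))) (-(k : ℝ)) from
      integral_sub hbi hmi, hbint, hB]
    linarith
  calc _ ≤ ∫⁻ θ in Set.Ioc 0 (2 * Real.pi), liminf (fun k => f k θ) atTop := by
        refine lintegral_mono_ae ?_
        filter_upwards [hg.ae_ne x w hx] with θ hθ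
        rw [logPot, if_neg hθ]
        refine le_liminf_of_le (by isBoundedDefault) ?_
        obtain ⟨N, hN⟩ := exists_nat_ge (-Real.log (g (p θ)))
        filter_upwards [eventually_ge_atTop N] with k hk
        have : (N : ℝ) ≤ k := by exact_mod_cast hk
        rw [hf]
        dsimp only
        rw [max_eq_left (by linarith)]
    _ ≤ liminf (fun k => ∫⁻ θ in Set.Ioc 0 (2 * Real.pi), f k θ) atTop := lintegral_liminf_le hfm
    _ ≤ _ := liminf_le_of_frequently_le' (Frequently.of_forall h1)

lemma heatKernel_mul_sq_le {s : ℝ} (hs : 0 < s) (z : ℂ) :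
    heatKernel s z * ENNReal.ofReal (‖z‖ ^ 2) ≤ ENNReal.ofReal (2 * s) * heatKernel (2 * s) z := by
  rw [heatKernel, heatKernel, ← ENNReal.ofReal_mul (by positivity), ← ENNReal.ofReal_mul (by positivity)]
  apply ENNReal.ofReal_le_ofReal
  have h1 : ‖z‖ ^ 2 / s ≤ Real.exp (‖z‖ ^ 2 / (2 * s)) := by
    have h2 := Real.quadratic_le_exp_of_nonneg (x := ‖z‖ ^ 2 / (2 * s)) (by positivity)
    have h3 : ‖z‖ ^ 2 / s = 2 * (‖z‖ ^ 2 / (2 * s)) := by field_simp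
    nlinarith [sq_nonneg (‖z‖ ^ 2 / (2 * s) - 1)]
  have h4 : Real.exp (-(‖z‖ ^ 2 / s)) * Real.exp (‖z‖ ^ 2 / (2 * s)) =
      Real.exp (-(‖z‖ ^ 2 / (2 * s))) := by
    rw [← Real.exp_add]; congr 1; field_simp; ring
  calc _ = Real.pi⁻¹ * (Real.exp (-(‖z‖ ^ 2 / s)) * (‖z‖ ^ 2 / s)) := by field_simp
    _ ≤ Real.pi⁻¹ * (Real.exp (-(‖z‖ ^ 2 / s)) * Real.exp (‖z‖ ^ 2 / (2 * s))) := by gcongr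
    _ = _ := by rw [h4]; field_simp

lemma heatSuper (hg : LogSub g D) (hne : ∃ x, g x ≠ 0) : HeatSuper (logPot g D) (2 * D) := by
  refine ⟨hg.lowerSemicontinuous_logPot, fun s hs x => ?_, ?_⟩
  · have hm := hg.measurable_logPot
    have hrot : ∀ θ : ℝ, heatOp s (logPot g D) x =
        ∫⁻ z, heatKernel s z * logPot g D (x + Complex.exp (θ * Complex.I) * z) := by
      intro θ
      have hmp := (rotation (Circle.exp θ)).measurePreserving
      rw [heatOp, ← lintegral_add_left_eq_self _ x, ← hmp.lintegral_comp (by fun_prop)]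
      refine lintegral_congr fun z => ?_
      rw [rotation_apply, Circle.coe_exp, ← heatKernel_neg s]
      congr 1
      simp [heatKernel, Complex.norm_exp_ofReal_mul_I]
    have hpi : ENNReal.ofReal (2 * Real.pi) ≠ 0 := by simp [Real.pi_pos]
    have h1 : ENNReal.ofReal (2 * Real.pi) * heatOp s (logPot g D) x ≤
        ENNReal.ofReal (2 * Real.pi) * (logPot g D x + ENNReal.ofReal ((2 * D : ℝ≥0) * s)) := by
      calc _ = ∫⁻ θ in Set.Ioc (0 : ℝ) (2 * Real.pi), heatOp s (logPot g D) x := by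
            rw [setLIntegral_const, Real.volume_Ioc, sub_zero, mul_comm]
        _ = ∫⁻ θ in Set.Ioc (0 : ℝ) (2 * Real.pi),
              (∫⁻ z, heatKernel s z * logPot g D (x + Complex.exp (θ * Complex.I) * z)) :=
            lintegral_congr fun θ => hrot θ
        _ = ∫⁻ z, heatKernel s z * ∫⁻ θ in Set.Ioc (0 : ℝ) (2 * Real.pi),
              logPot g D (x + Complex.exp (θ * Complex.I) * z) := by
            rw [lintegral_lintegral_swap (by fun_prop)]
            refine lintegral_congr fun z => ?_
            rw [lintegral_const_mul _ (by fun_prop)]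
        _ ≤ ∫⁻ z, (ENNReal.ofReal (2 * Real.pi) * logPot g D x * heatKernel s z +
              ENNReal.ofReal (2 * Real.pi) * ENNReal.ofReal D *
                (ENNReal.ofReal (2 * s) * heatKernel (2 * s) z)) := by
            refine lintegral_mono fun z => ?_
            calc _ ≤ heatKernel s z * (ENNReal.ofReal (2 * Real.pi) *
                  (logPot g D x + ENNReal.ofReal (D * ‖z‖ ^ 2))) := by
                  gcongr
                  exact hg.lintegral_circle_logPot_le x z
              _ = ENNReal.ofReal (2 * Real.pi) * logPot g D x * heatKernel s z +
                  ENNReal.ofReal (2 * Real.pi) * ENNReal.ofReal D *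
                    (heatKernel s z * ENNReal.ofReal (‖z‖ ^ 2)) := by
                  rw [ENNReal.ofReal_mul (NNReal.coe_nonneg D)]
                  ring
              _ ≤ _ := by
                  exact add_le_add le_rfl (mul_le_mul_right (heatKernel_mul_sq_le hs z) _)
        _ = _ := by
            rw [lintegral_add_left (by fun_prop), lintegral_const_mul _ (by fun_prop),
              lintegral_const_mul _ (by fun_prop), lintegral_const_mul _ (by fun_prop),
              lintegral_heatKernel hs, lintegral_heatKernel (by positivity), mul_one, mul_one,
              mul_assoc, ← ENNReal.ofReal_mul (NNReal.coe_nonneg D), ← mul_add]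
            congr 3
            push_cast
            ring
    exact (ENNReal.mul_le_mul_iff_right hpi ENNReal.ofReal_ne_top).1 h1
  · obtain ⟨x, hx⟩ := hne
    exact ⟨x, by rw [logPot, if_neg hx]; exact ENNReal.ofReal_ne_top⟩

/-- A quantitative maximum principle on discs. -/
lemma le_of_le_circle (hg : LogSub g D) {R M : ℝ} (hR : 0 < R) (hM : ∀ z, ‖z‖ = R → g z ≤ M)
    {z : ℂ} (hz : ‖z‖ ≤ R) : g z ≤ Real.exp 1 * M := by
  have hM0 : 0 ≤ M := (hg.nonneg _).trans (hM (R : ℂ) (by simp [hR.le]))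
  set F : ℂ → ℝ := fun z => g z * Real.exp (‖z‖ ^ 2 / R ^ 2) with hF
  have hFu : UpperSemicontinuous F := by
    intro x y hxy
    have hu : UpperSemicontinuous fun ζ => g ζ + -(y * Real.exp (-(‖ζ‖ ^ 2 / R ^ 2))) :=
      hg.usc.add (Continuous.upperSemicontinuous (by fun_prop))
    have heq : ∀ ζ, F ζ < y ↔ g ζ + -(y * Real.exp (-(‖ζ‖ ^ 2 / R ^ 2))) < 0 := by
      intro ζ
      rw [Real.exp_neg, hF, ← lt_div_iff₀ (Real.exp_pos _), div_eq_mul_inv]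
      constructor <;> intro h <;> linarith
    rw [heq] at hxy
    filter_upwards [hu x 0 hxy] with ζ hζ using (heq ζ).2 hζ
  obtain ⟨p, hp, hmax⟩ := (hFu.upperSemicontinuousOn (Metric.closedBall 0 R)).exists_isMaxOn
    ⟨0, by simp [hR.le]⟩ (isCompact_closedBall 0 R)
  rw [mem_closedBall_zero_iff] at hp
  have hle : ∀ ζ, ‖ζ‖ ≤ R → F ζ ≤ F p := fun ζ hζ => hmax (by simpa using hζ)
  have hgF : g z ≤ F p := by
    refine le_trans ?_ (hle z hz)
    exact le_mul_of_one_le_right (hg.nonneg z) (Real.one_le_exp (by positivity))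
  refine hgF.trans ?_
  rcases hp.eq_or_lt with hpR | hpR
  · rw [hF]
    dsimp only
    rw [hpR, div_self (by positivity), mul_comm]
    gcongr
    exact hM p hpR
  by_cases hgp : g p = 0
  · rw [hF]
    dsimp only
    rw [hgp, zero_mul]
    positivity
  exfalso
  have hgp' : 0 < g p := (hg.nonneg p).lt_of_ne' hgp
  set s := R - ‖p‖ with hs
  have hs0 : 0 < s := by linarith
  have hmean := hg.mean p (s : ℂ) hgp (Real.log (g p) - 1)
  set q : ℝ → ℂ := fun θ => p + Complex.exp (θ * Complex.I) * (s : ℂ) with hq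
  have hqc : Continuous q := by fun_prop
  have hqR : ∀ θ, ‖q θ‖ ≤ R := fun θ => by
    refine (norm_add_le _ _).trans ?_
    rw [norm_mul, Complex.norm_exp_ofReal_mul_I, one_mul, Complex.norm_real,
      Real.norm_of_nonneg hs0.le]
    linarith
  have hlog : ∀ ζ, g ζ ≠ 0 → Real.log (F ζ) = Real.log (g ζ) + ‖ζ‖ ^ 2 / R ^ 2 := fun ζ hζ => by
    rw [hF]
    dsimp only
    rw [Real.log_mul hζ (Real.exp_pos _).ne', Real.log_exp]
  have hpi := Real.pi_pos
  have hint : ∫ θ in (0 : ℝ)..(2 * Real.pi), max (Real.log (g (q θ))) (Real.log (g p) - 1) ≤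
      ∫ θ in (0 : ℝ)..(2 * Real.pi),
        (Real.log (g p) + ‖p‖ ^ 2 / R ^ 2 - ‖q θ‖ ^ 2 / R ^ 2) := by
    rw [intervalIntegral.integral_of_le (by positivity),
      intervalIntegral.integral_of_le (by positivity)]
    have hgi : IntegrableOn (fun θ => Real.log (g p) + ‖p‖ ^ 2 / R ^ 2 - ‖q θ‖ ^ 2 / R ^ 2)
        (Set.Ioc 0 (2 * Real.pi)) :=
      (Continuous.integrableOn_Icc (by fun_prop)).mono_set Set.Ioc_subset_Icc_self
    have hle' : (fun θ => max (Real.log (g (q θ))) (Real.log (g p) - 1)) ≤ᵐ[volume.restrict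
        (Set.Ioc 0 (2 * Real.pi))] fun θ => Real.log (g p) + ‖p‖ ^ 2 / R ^ 2 - ‖q θ‖ ^ 2 / R ^ 2 := by
      filter_upwards [hg.ae_ne p (s : ℂ) hgp] with θ hθ
      have hθ' : 0 < g (q θ) := (hg.nonneg _).lt_of_ne' hθ
      refine max_le ?_ ?_
      · have := Real.log_le_log (by positivity) (hle (q θ) (hqR θ))
        rw [hlog _ hθ, hlog _ hgp] at this
        linarith
      · have : ‖q θ‖ ^ 2 / R ^ 2 ≤ 1 := by
          rw [div_le_one (by positivity)]
          have := hqR θ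
          gcongr
        have : 0 ≤ ‖p‖ ^ 2 / R ^ 2 := by positivity
        linarith
    refine integral_mono_ae ?_ hgi hle'
    have hm : Measurable fun θ => max (Real.log (g (q θ))) (Real.log (g p) - 1) :=
      (Real.measurable_log.comp (hg.usc.measurable.comp hqc.measurable)).max measurable_const
    refine (hgi.norm.add (integrableOn_const (C := |Real.log (g p) - 1|) measure_Ioc_lt_top.ne)).mono'
      hm.aestronglyMeasurable ?_
    filter_upwards [hle'] with θ hθ
    simp only [Pi.add_apply, Real.norm_eq_abs]
    rw [abs_le]
    have h1 := neg_abs_le (Real.log (g p) - 1)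
    have h2 := abs_nonneg (Real.log (g p) - 1)
    have h3 := le_abs_self (Real.log (g p) + ‖p‖ ^ 2 / R ^ 2 - ‖q θ‖ ^ 2 / R ^ 2)
    have h4 := abs_nonneg (Real.log (g p) + ‖p‖ ^ 2 / R ^ 2 - ‖q θ‖ ^ 2 / R ^ 2)
    have h5 := le_max_right (Real.log (g (q θ))) (Real.log (g p) - 1)
    constructor <;> linarith
  rw [intervalIntegral.integral_sub (by simp) (Continuous.intervalIntegrable (by fun_prop) _ _),
    intervalIntegral.integral_div, integral_norm_add_exp_mul_sq, intervalIntegral.integral_const,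
    Complex.norm_real, Real.norm_of_nonneg hs0.le] at hint
  rw [one_div, inv_mul_eq_div, le_div_iff₀ (by positivity)] at hmean
  have h6 := hmean.trans hint
  have h7 : (2 * Real.pi - 0) • (Real.log (g p) + ‖p‖ ^ 2 / R ^ 2) -
      2 * Real.pi * (‖p‖ ^ 2 + s ^ 2) / R ^ 2 =
      Real.log (g p) * (2 * Real.pi) - 2 * Real.pi * (s ^ 2 / R ^ 2) := by
    rw [smul_eq_mul]; ring
  rw [h7] at h6
  have : 0 < 2 * Real.pi * (s ^ 2 / R ^ 2) := by positivity
  linarith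

end LogSub

/-- The quotient whose upper limit at `0` is the Lelong number. -/
def lelongQuot (g : ℂ → ℝ) (r : ℝ) : ℝ :=
  (⨆ θ : ℝ, Real.log (g ((r : ℂ) * Complex.exp (θ * Complex.I)))) / Real.log r

lemma eventually_mem_Ioo_nhdsGT {ρ : ℝ} (hρ : 0 < ρ) : ∀ᶠ r in 𝓝[>] (0 : ℝ), 0 < r ∧ r < ρ :=
  Ioo_mem_nhdsGT hρ

lemma eventually_log_lt (c : ℝ) : ∀ᶠ r in 𝓝[>] (0 : ℝ), Real.log r < c :=
  Real.tendsto_log_nhdsGT_zero.eventually_lt_atBot c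

namespace LogSub
variable {g k : ℂ → ℝ} {D E : ℝ≥0}

lemma log_circle_le (hg : LogSub g D) (r θ : ℝ) :
    Real.log (g ((r : ℂ) * Complex.exp (θ * Complex.I))) ≤ D * (1 + r ^ 2) := by
  refine (hg.log_le _).trans_eq ?_
  rw [norm_mul, Complex.norm_exp_ofReal_mul_I, mul_one, Complex.norm_real, Real.norm_eq_abs, sq_abs]

lemma bddAbove_circle (hg : LogSub g D) (r : ℝ) :
    BddAbove (Set.range fun θ : ℝ => Real.log (g ((r : ℂ) * Complex.exp (θ * Complex.I)))) :=
  ⟨D * (1 + r ^ 2), by rintro _ ⟨θ, rfl⟩; exact hg.log_circle_le r θ⟩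

lemma log_le_iSup_circle (hg : LogSub g D) {r : ℝ} {ζ : ℂ} (hζ : ‖ζ‖ = r) :
    Real.log (g ζ) ≤ ⨆ θ : ℝ, Real.log (g ((r : ℂ) * Complex.exp (θ * Complex.I))) := by
  refine le_ciSup_of_le (hg.bddAbove_circle r) (Complex.arg ζ) (le_of_eq ?_)
  rw [← hζ, Complex.norm_mul_exp_arg_mul_I]

lemma eventually_lt_lelongQuot (hg : LogSub g D) {a : ℝ} (ha : a < 0) :
    ∀ᶠ r in 𝓝[>] (0 : ℝ), a < lelongQuot g r := by
  filter_upwards [eventually_mem_Ioo_nhdsGT one_pos, eventually_log_lt (2 * D / a)]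
    with r ⟨hr0, hr1⟩ hlog
  have hl : Real.log r < 0 := Real.log_neg hr0 hr1
  rw [lelongQuot, lt_div_iff_of_neg hl]
  have h1 : ⨆ θ : ℝ, Real.log (g ((r : ℂ) * Complex.exp (θ * Complex.I))) ≤ D * (1 + r ^ 2) :=
    ciSup_le fun θ => hg.log_circle_le r θ
  have h2 : (D : ℝ) * (1 + r ^ 2) ≤ 2 * D := by
    have h3 : 1 + r ^ 2 ≤ 2 := by nlinarith
    have := mul_le_mul_of_nonneg_left h3 D.coe_nonneg
    linarith
  rw [lt_div_iff_of_neg ha] at hlog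
  linarith

/-- A nonvanishing Lelong number forces polynomial decay along a sequence of discs. -/
lemma exists_frequently_le_rpow (hg : LogSub g D)
    (hne : limsup (lelongQuot g) (𝓝[>] 0) ≠ 0) :
    ∃ ν : ℝ, 0 < ν ∧ ∃ᶠ r in 𝓝[>] (0 : ℝ), ∀ ζ : ℂ, ‖ζ‖ ≤ r → g ζ ≤ Real.exp 1 * r ^ ν := by
  rcases hne.lt_or_gt with hL | hL
  · exfalso
    rw [limsup_eq] at hL
    have hS : {a | ∀ᶠ r in 𝓝[>] (0 : ℝ), lelongQuot g r ≤ a}.Nonempty := by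
      by_contra h0
      rw [Set.not_nonempty_iff_eq_empty] at h0
      simp [h0] at hL
    obtain ⟨a, ha, ha0⟩ := exists_lt_of_csInf_lt hS hL
    obtain ⟨r, h1, h2⟩ := ((show ∀ᶠ r in 𝓝[>] (0 : ℝ), lelongQuot g r ≤ a from ha).and (hg.eventually_lt_lelongQuot ha0)).exists
    exact absurd h1 (not_le.2 h2)
  set L := limsup (lelongQuot g) (𝓝[>] 0) with hLdef
  have hb : IsBoundedUnder (· ≥ ·) (𝓝[>] (0 : ℝ)) (lelongQuot g) :=
    ⟨-1, (hg.eventually_lt_lelongQuot (neg_one_lt_zero)).mono fun _ h => h.le⟩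
  have hf : ∃ᶠ r in 𝓝[>] (0 : ℝ), L / 2 < lelongQuot g r :=
    frequently_lt_of_lt_limsup hb.isCoboundedUnder_le (by linarith)
  refine ⟨L / 2, by linarith, ?_⟩
  refine (hf.and_eventually (eventually_mem_Ioo_nhdsGT one_pos)).mono ?_
  rintro r ⟨hr, hr0, hr1⟩ ζ hζ
  have hl : Real.log r < 0 := Real.log_neg hr0 hr1
  refine hg.le_of_le_circle hr0 (fun z hz => ?_) hζ
  by_cases hz0 : g z = 0
  · rw [hz0]; positivity
  rw [lelongQuot, lt_div_iff_of_neg hl] at hr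
  rw [Real.rpow_def_of_pos hr0, ← Real.log_le_iff_le_exp ((hg.nonneg z).lt_of_ne' hz0)]
  linarith [hg.log_le_iSup_circle hz]

lemma isBoundedUnder_lelongQuot (hg : LogSub g D) (hk : LogSub k E)
    (hgk : ∀ w, w ≠ 0 → k w = ‖w‖ * g w⁻¹) (hne : ∃ w, k w ≠ 0) :
    IsBoundedUnder (· ≤ ·) (𝓝[>] (0 : ℝ)) (lelongQuot g) := by
  obtain ⟨w₀, hw₀⟩ := hne
  refine ⟨2, ?_⟩
  rw [eventually_map]
  filter_upwards [eventually_mem_Ioo_nhdsGT one_pos,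
    eventually_mem_Ioo_nhdsGT (ρ := (‖w₀‖ + 1)⁻¹) (by positivity),
    eventually_log_lt (Real.log (k w₀) - 1)] with r ⟨hr0, hr1⟩ ⟨_, hr2⟩ hlog
  have hl : Real.log r < 0 := Real.log_neg hr0 hr1
  rw [lelongQuot, div_le_iff_of_neg hl]
  set S := ⨆ θ : ℝ, Real.log (g ((r : ℂ) * Complex.exp (θ * Complex.I))) with hS
  by_cases hz : ∃ ζ : ℂ, ‖ζ‖ = r ∧ g ζ = 0
  · obtain ⟨ζ, hζ, h0⟩ := hz
    have := hg.log_le_iSup_circle hζ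
    rw [h0, Real.log_zero] at this
    linarith
  push Not at hz
  have hkw : ∀ w : ℂ, ‖w‖ = r⁻¹ → k w ≤ r⁻¹ * Real.exp S := by
    intro w hw
    have hw0 : w ≠ 0 := by
      rintro rfl
      rw [norm_zero] at hw
      exact (inv_pos.2 hr0).ne hw
    have hwi : ‖w⁻¹‖ = r := by rw [norm_inv, hw, inv_inv]
    rw [hgk w hw0, hw]
    gcongr
    rw [← Real.log_le_iff_le_exp ((hg.nonneg _).lt_of_ne' (hz _ hwi))]
    exact hg.log_le_iSup_circle hwi
  have hw₀r : ‖w₀‖ ≤ r⁻¹ := by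
    have := (lt_inv_comm₀ hr0 (by positivity)).1 hr2
    linarith
  have h1 := hk.le_of_le_circle (inv_pos.2 hr0) hkw hw₀r
  have h2 := Real.log_le_log ((hk.nonneg _).lt_of_ne' hw₀) h1
  rw [Real.log_mul (Real.exp_pos _).ne' (by positivity), Real.log_mul (by positivity)
    (Real.exp_pos _).ne', Real.log_exp, Real.log_exp, Real.log_inv] at h2
  linarith

lemma logPot_le {ζ : ℂ} (hζ : ‖ζ‖ ≤ 1) (h0 : g ζ ≠ 0) :
    logPot g D ζ ≤ ENNReal.ofReal (2 * D - Real.log (g ζ)) := by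
  rw [logPot, if_neg h0]
  apply ENNReal.ofReal_le_ofReal
  have : ‖ζ‖ ^ 2 ≤ 1 := by have := norm_nonneg ζ; nlinarith
  have := D.coe_nonneg
  nlinarith

/-- If the Lelong number vanishes, sublevel sets of `g` near `0` have superpolynomially
small area. -/
lemma exists_sublevel_decay (hg : LogSub g D) (hne : ∃ ζ, g ζ ≠ 0)
    (hb : IsBoundedUnder (· ≤ ·) (𝓝[>] (0 : ℝ)) (lelongQuot g))
    (h0 : limsup (lelongQuot g) (𝓝[>] 0) = 0) {t : ℝ} (ht : 0 < t) :
    ∃ ρ : ℝ, 0 < ρ ∧ ∃ K : ℝ≥0∞, K ≠ ⊤ ∧ ∀ s : ℝ, 0 < s →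
      volume {ζ ∈ Metric.ball (0 : ℂ) ρ | s * g ζ < 1} ≤ K * ENNReal.ofReal ((1 + s) ^ (-t)) := by
  have hv := hg.heatSuper hne
  have hsmall : ∀ δ > 0, ∀ r₀ > 0, ∃ r : ℝ, 0 < r ∧ r < r₀ ∧ ∃ y : ℂ, ‖y - 0‖ = r ∧
      logPot g D y ≤ ENNReal.ofReal (δ * Real.log (1 / r)) := by
    intro δ hδ r₀ hr₀
    have hev : ∀ᶠ r in 𝓝[>] (0 : ℝ), lelongQuot g r < δ / 2 :=
      eventually_lt_of_limsup_lt (by rw [h0]; positivity) hb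
    have hev2 := (hev.and ((eventually_mem_Ioo_nhdsGT hr₀).and
      ((eventually_mem_Ioo_nhdsGT one_pos).and (eventually_log_lt (-(4 * D / δ))))))
    rw [eventually_nhdsWithin_iff] at hev2
    obtain ⟨ε, hε, hball⟩ := Metric.eventually_nhds_iff.1 hev2
    obtain ⟨r, hr0, hrε, hcirc⟩ := hv.exists_circle_ne_top 0 hε
    obtain ⟨hq, ⟨_, hrr⟩, ⟨_, hr1⟩, hlog⟩ := hball (y := r)
      (by rw [Real.dist_eq, sub_zero, abs_of_pos hr0]; exact hrε) hr0
    have hl : Real.log r < 0 := Real.log_neg hr0 hr1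
    rw [lelongQuot, div_lt_iff_of_neg hl] at hq
    obtain ⟨θ, hθ⟩ := exists_lt_of_lt_ciSup hq
    have hnorm : ‖(r : ℂ) * Complex.exp (θ * Complex.I)‖ = r := by
      rw [norm_mul, Complex.norm_exp_ofReal_mul_I, mul_one, Complex.norm_real,
        Real.norm_of_nonneg hr0.le]
    refine ⟨r, hr0, hrr, _, by rw [sub_zero, hnorm], ?_⟩
    have hg0 : g ((r : ℂ) * Complex.exp (θ * Complex.I)) ≠ 0 := fun h =>
      hcirc _ (by rw [sub_zero, hnorm]) (by rw [logPot, if_pos h])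
    refine (logPot_le (by rw [hnorm]; exact hr1.le) hg0).trans (ENNReal.ofReal_le_ofReal ?_)
    rw [one_div, Real.log_inv]
    have h4 : 4 * D / δ * (δ / 2) = 2 * D := by field_simp; ring
    nlinarith
  obtain ⟨m, hm, hmass⟩ := hv.exists_massBound_le 0 hsmall (η := Real.pi / (2 * t)) (by positivity)
  obtain ⟨K, hK, hdec⟩ := hv.exists_superlevel_decay 0 hm ht hmass
  set ρ := √(m : ℝ)⁻¹ / 2 with hρ
  have hm0 : (0 : ℝ) < m := by exact_mod_cast (by omega : 0 < m)
  refine ⟨ρ, by positivity, ENNReal.ofReal (2 ^ t) * (K + volume (Metric.ball (0 : ℂ) ρ)), ?_, ?_⟩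
  · exact ENNReal.mul_ne_top ENNReal.ofReal_ne_top
      (ENNReal.add_ne_top.2 ⟨hK, measure_ball_lt_top.ne⟩)
  intro s hs
  have hone : ∀ u : ℝ, 0 < u → 1 + s ≤ 2 * u → u ^ (-t) ≤ 2 ^ t * (1 + s) ^ (-t) := by
    intro u hu hus
    have h1 : (2 * u) ^ (-t) ≤ (1 + s) ^ (-t) :=
      Real.rpow_le_rpow_of_nonpos (by positivity) hus (by linarith)
    rw [Real.mul_rpow (by norm_num) hu.le, Real.rpow_neg (by norm_num : (0 : ℝ) ≤ 2),
      inv_mul_le_iff₀ (by positivity)] at h1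
    exact h1
  rw [mul_assoc, mul_comm (K + _), ← mul_assoc, ← ENNReal.ofReal_mul (by positivity)]
  rcases le_or_gt 1 s with h1s | h1s
  · calc _ ≤ volume {x ∈ Metric.ball (0 : ℂ) ρ | ENNReal.ofReal (Real.log s) < logPot g D x} := by
          refine measure_mono fun ζ hζ => ⟨hζ.1, ?_⟩
          rw [hg.lt_logPot_iff (Real.log_nonneg h1s), sub_eq_add_neg, Real.exp_add, Real.exp_neg,
            Real.exp_log hs]
          have h2 : g ζ < s⁻¹ := by
            rw [← one_div, lt_div_iff₀ hs, mul_comm]; exact hζ.2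
          refine h2.trans_le (le_mul_of_one_le_left (by positivity) (Real.one_le_exp ?_))
          positivity
      _ ≤ K * ENNReal.ofReal (Real.exp (-(t * Real.log s))) := hdec _
      _ ≤ (K + volume (Metric.ball (0 : ℂ) ρ)) * ENNReal.ofReal (2 ^ t * (1 + s) ^ (-t)) := by
          refine mul_le_mul' le_self_add (ENNReal.ofReal_le_ofReal ?_)
          refine le_trans (le_of_eq ?_) (hone s hs (by linarith))
          rw [Real.rpow_def_of_pos hs]
          congr 1
          ring
      _ = _ := mul_comm _ _
  · calc _ ≤ volume (Metric.ball (0 : ℂ) ρ) := measure_mono fun ζ hζ => hζ.1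
      _ ≤ ENNReal.ofReal (2 ^ t * (1 + s) ^ (-t)) * (K + volume (Metric.ball (0 : ℂ) ρ)) := by
          rw [← one_mul (volume (Metric.ball (0 : ℂ) ρ))]
          refine mul_le_mul' ?_ (by rw [one_mul]; exact le_add_self)
          rw [ENNReal.one_le_ofReal]
          have := hone 1 one_pos (by linarith)
          rwa [Real.one_rpow] at this

end LogSub

/-- The sublevel sets of `G` in `S` have area decaying like a power. -/
def SublevelDecay (G : ℂ → ℝ) (t : ℝ) (S : Set ℂ) : Prop :=
  ∃ K : ℝ≥0∞, K ≠ ⊤ ∧ ∀ s : ℝ, 0 < s →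
    volume {ζ ∈ S | s * G ζ < 1} ≤ K * ENNReal.ofReal ((1 + s) ^ (-t))

namespace SublevelDecay
variable {G : ℂ → ℝ} {t : ℝ} {S T : Set ℂ}

lemma mono (hT : SublevelDecay G t T) (hST : S ⊆ T) : SublevelDecay G t S := by
  obtain ⟨K, hK, h⟩ := hT
  refine ⟨K, hK, fun s hs => le_trans (measure_mono ?_) (h s hs)⟩
  exact fun ζ hζ => ⟨hST hζ.1, hζ.2⟩

lemma empty : SublevelDecay G t ∅ := ⟨0, by simp, by simp⟩

lemma union (hS : SublevelDecay G t S) (hT : SublevelDecay G t T) : SublevelDecay G t (S ∪ T) := by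
  obtain ⟨K, hK, h⟩ := hS
  obtain ⟨L, hL, h'⟩ := hT
  refine ⟨K + L, ENNReal.add_ne_top.2 ⟨hK, hL⟩, fun s hs => ?_⟩
  rw [add_mul]
  refine le_trans (measure_mono ?_) ((measure_union_le _ _).trans (add_le_add (h s hs) (h' s hs)))
  rintro ζ ⟨h1 | h1, h2⟩
  · exact Or.inl ⟨h1, h2⟩
  · exact Or.inr ⟨h1, h2⟩

lemma translate {x : ℂ} {ρ : ℝ} (h : SublevelDecay (fun ζ => G (x + ζ)) t (Metric.ball 0 ρ)) :
    SublevelDecay G t (Metric.ball x ρ) := by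
  obtain ⟨K, hK, h⟩ := h
  refine ⟨K, hK, fun s hs => le_of_eq_of_le ?_ (h s hs)⟩
  rw [← measure_preimage_add volume x]
  congr 1
  ext ζ
  simp

lemma of_isCompact (hS : IsCompact S)
    (h : ∀ x ∈ S, ∃ ρ : ℝ, 0 < ρ ∧ SublevelDecay G t (Metric.ball x ρ)) : SublevelDecay G t S := by
  refine hS.induction_on empty (fun _ _ hST hT => hT.mono hST) (fun _ _ => union) fun x hx => ?_
  obtain ⟨ρ, hρ, hd⟩ := h x hx
  exact ⟨_, mem_nhdsWithin_of_mem_nhds (Metric.ball_mem_nhds x hρ), hd⟩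

end SublevelDecay

lemma volume_mul_left_image (w : ℂ) (S : Set ℂ) :
    volume ((fun ζ => w * ζ) '' S) = ENNReal.ofReal (‖w‖ ^ 2) * volume S := by
  have h := Measure.addHaar_image_linearMap (volume : Measure ℂ) (Algebra.lmul ℝ ℂ w) S
  rw [← Algebra.norm_apply, Algebra.norm_complex_apply, Complex.normSq_eq_norm_sq,
    abs_of_nonneg (by positivity)] at h
  exact h

/-- Integrability over the part of a balanced domain lying in the cone over `S`. -/
lemma lintegral_cone_lt_top {H : ℂ × ℂ → ℝ} (hH : Measurable H)
    (hhom : ∀ c z w : ℂ, H (c * z, c * w) = ‖c‖ * H (z, w)) {S : Set ℂ} (hS : MeasurableSet S)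
    {R : ℝ} (hR : ∀ ζ ∈ S, ‖ζ‖ ≤ R) (N : ℕ)
    (hdec : SublevelDecay (fun ζ => H (ζ, 1)) (N + 5) S) :
    ∫⁻ p in {p : ℂ × ℂ | p.2 ≠ 0 ∧ p.1 / p.2 ∈ S ∧ H p < 1},
      ENNReal.ofReal ((1 + ‖p.1‖ + ‖p.2‖) ^ N) < ⊤ := by
  obtain ⟨K, hK, hdec⟩ := hdec
  set A : Set (ℂ × ℂ) := {p | p.2 ≠ 0 ∧ p.1 / p.2 ∈ S ∧ H p < 1} with hA
  have hAm : MeasurableSet A := by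
    refine MeasurableSet.inter ?_ (MeasurableSet.inter ?_ ?_)
    · exact (measurableSet_singleton (0 : ℂ)).compl.preimage measurable_snd
    · exact hS.preimage (measurable_fst.div measurable_snd)
    · exact measurableSet_lt hH measurable_const
  set F : ℂ × ℂ → ℝ≥0∞ := fun p => ENNReal.ofReal ((1 + ‖p.1‖ + ‖p.2‖) ^ N) with hF
  have hFm : Measurable F := by fun_prop
  set R' := max R 0 with hR'
  have hslice : ∀ w : ℂ, ∫⁻ z, A.indicator F (z, w) ≤
      ENNReal.ofReal ((R' + 1) ^ N) * K * ENNReal.ofReal ((1 + ‖w‖) ^ (-3 : ℝ)) := by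
    intro w
    by_cases hw : w = 0
    · have : ∀ z, A.indicator F (z, w) = 0 := fun z => by
        rw [Set.indicator_of_notMem]
        simp [hA, hw]
      simp [this]
    have hw0 : 0 < ‖w‖ := norm_pos_iff.2 hw
    set T : Set ℂ := (fun ζ => w * ζ) '' {ζ ∈ S | ‖w‖ * H (ζ, 1) < 1} with hT
    have hle : ∀ z, A.indicator F (z, w) ≤
        T.indicator (fun _ => ENNReal.ofReal ((R' + 1) ^ N * (1 + ‖w‖) ^ N)) z := by
      intro z
      by_cases hz : (z, w) ∈ A
      · have hzw : z = w * (z / w) := by field_simp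
        have hzT : z ∈ T := by
          refine ⟨z / w, ⟨hz.2.1, ?_⟩, hzw.symm⟩
          rw [← hhom, ← hzw, mul_one]
          exact hz.2.2
        rw [Set.indicator_of_mem hz, Set.indicator_of_mem hzT, hF, ← mul_pow]
        refine ENNReal.ofReal_le_ofReal (pow_le_pow_left₀ (by positivity) ?_ _)
        have h1 : ‖z‖ ≤ ‖w‖ * R' := by
          rw [hzw, norm_mul]
          gcongr
          exact (hR _ hz.2.1).trans (le_max_left _ _)
        have h2 : 0 ≤ R' := le_max_right _ _
        dsimp only
        nlinarith
      · rw [Set.indicator_of_notMem hz]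
        exact zero_le
    calc _ ≤ ∫⁻ z, T.indicator (fun _ => ENNReal.ofReal ((R' + 1) ^ N * (1 + ‖w‖) ^ N)) z :=
          lintegral_mono hle
      _ ≤ ENNReal.ofReal ((R' + 1) ^ N * (1 + ‖w‖) ^ N) * volume T := lintegral_indicator_const_le _ _
      _ ≤ ENNReal.ofReal ((R' + 1) ^ N * (1 + ‖w‖) ^ N) * (ENNReal.ofReal (‖w‖ ^ 2) *
            (K * ENNReal.ofReal ((1 + ‖w‖) ^ (-((N : ℝ) + 5))))) := by
          rw [hT, volume_mul_left_image]
          gcongr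
          exact hdec _ hw0
      _ = ENNReal.ofReal ((R' + 1) ^ N) * K * ENNReal.ofReal ((1 + ‖w‖) ^ N * ‖w‖ ^ 2 *
            (1 + ‖w‖) ^ (-((N : ℝ) + 5))) := by
          rw [ENNReal.ofReal_mul (by positivity), ENNReal.ofReal_mul (by positivity),
            ENNReal.ofReal_mul (by positivity)]
          ring
      _ ≤ _ := by
          gcongr
          have h3 : (1 + ‖w‖) ^ (-3 : ℝ) =
              (1 + ‖w‖) ^ N * (1 + ‖w‖) ^ 2 * (1 + ‖w‖) ^ (-((N : ℝ) + 5)) := by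
            rw [← Real.rpow_natCast, ← Real.rpow_natCast, ← Real.rpow_add (by positivity),
              ← Real.rpow_add (by positivity)]
            congr 1
            push_cast
            ring
          rw [h3]
          gcongr
          linarith
  rw [← lintegral_indicator hAm, Measure.volume_eq_prod,
    lintegral_prod_symm _ (hFm.indicator hAm).aemeasurable]
  refine (lintegral_mono hslice).trans_lt ?_
  rw [lintegral_const_mul _ (by fun_prop)]
  exact ENNReal.mul_lt_top (ENNReal.mul_lt_top ENNReal.ofReal_lt_top hK.lt_top)
    (finite_integral_one_add_norm (by rw [Complex.finrank_real_complex]; norm_num))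

lemma MvPolynomial.exists_norm_eval_le (P : MvPolynomial (Fin 2) ℂ) :
    ∃ C : ℝ, 0 ≤ C ∧ ∃ d : ℕ, ∀ z : Fin 2 → ℂ,
      ‖MvPolynomial.eval z P‖ ≤ C * (1 + ‖z 0‖ + ‖z 1‖) ^ d := by
  induction P using MvPolynomial.induction_on with
  | C a => exact ⟨‖a‖, norm_nonneg _, 0, by simp⟩
  | add p q hp hq =>
    obtain ⟨C, hC, d, h⟩ := hp
    obtain ⟨C', hC', d', h'⟩ := hq
    refine ⟨C + C', by positivity, max d d', fun z => ?_⟩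
    rw [map_add, add_mul]
    have h1 : 1 ≤ 1 + ‖z 0‖ + ‖z 1‖ := by linarith [norm_nonneg (z 0), norm_nonneg (z 1)]
    refine (norm_add_le _ _).trans (add_le_add ((h z).trans ?_) ((h' z).trans ?_)) <;>
      gcongr <;> simp
  | mul_X p i hp =>
    obtain ⟨C, hC, d, h⟩ := hp
    refine ⟨C, hC, d + 1, fun z => ?_⟩
    rw [map_mul, MvPolynomial.eval_X, norm_mul, pow_succ, ← mul_assoc]
    refine mul_le_mul (h z) ?_ (norm_nonneg _) (by positivity)
    have := norm_nonneg (z 0)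
    have := norm_nonneg (z 1)
    fin_cases i <;> simp <;> linarith

lemma MvPolynomial.differentiable_eval (P : MvPolynomial (Fin 2) ℂ) :
    Differentiable ℂ fun z : Fin 2 → ℂ => MvPolynomial.eval z P := by
  induction P using MvPolynomial.induction_on with
  | C a => simp
  | add p q hp hq =>
    simp_rw [map_add]
    exact hp.add hq
  | mul_X p i hp =>
    simp_rw [map_mul, MvPolynomial.eval_X]
    exact hp.mul (differentiable_apply i)

lemma eq_smul_add_smul_single {i j : Fin 2} (hij : i ≠ j) {v : Fin 2 → ℂ} (hv : v j ≠ 0)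
    (z : Fin 2 → ℂ) :
    z = (z j / v j) • v + (z i - z j / v j * v i) • (Pi.single i 1 : Fin 2 → ℂ) := by
  ext k
  obtain rfl | rfl : k = i ∨ k = j := by omega
  · simp
  · simp [Pi.single_eq_of_ne hij.symm, hv]

lemma lelong_of_ne (h : (Fin 2 → ℂ) → ℝ) {v : Fin 2 → ℂ} (hv : v 1 ≠ 0) :
    lelong h v = limsup (lelongQuot fun ζ => h (v + ζ • Pi.single 0 1)) (𝓝[>] 0) := by
  have he : ∀ ζ : ℂ, v + ζ • (Pi.single 0 1 : Fin 2 → ℂ) = ![v 0 + ζ, v 1] := fun ζ => by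
    ext k
    fin_cases k <;> simp
  rw [lelong, if_pos hv]
  simp_rw [he]
  rfl

lemma lelong_of_eq (h : (Fin 2 → ℂ) → ℝ) {v : Fin 2 → ℂ} (hv : v 1 = 0) :
    lelong h v = limsup (lelongQuot fun ζ => h (v + ζ • Pi.single 1 1)) (𝓝[>] 0) := by
  have he : ∀ ζ : ℂ, v + ζ • (Pi.single 1 1 : Fin 2 → ℂ) = ![v 0, ζ] := fun ζ => by
    ext k
    fin_cases k <;> simp [hv]
  rw [lelong, if_neg (not_not.2 hv)]
  simp_rw [he]
  rfl

section
variable {h : (Fin 2 → ℂ) → ℝ}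

lemma LogPSH.exists_sublevelDecay (hpos : ∀ z, 0 ≤ h z) (husc : UpperSemicontinuous h)
    (hhom : AbsHomog h) (hpsh : LogPSH h) (hne : ∃ z, h z ≠ 0) {i j : Fin 2} (hij : i ≠ j)
    {v : Fin 2 → ℂ} (hv : v j ≠ 0)
    (h0 : limsup (lelongQuot fun ζ => h (v + ζ • Pi.single i 1)) (𝓝[>] 0) = 0) {t : ℝ} (ht : 0 < t) :
    ∃ ρ : ℝ, 0 < ρ ∧ SublevelDecay (fun ζ => h (v + ζ • Pi.single i 1)) t (Metric.ball 0 ρ) := by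
  set e : Fin 2 → ℂ := Pi.single i 1 with he
  obtain ⟨z, hz⟩ := hne
  rw [eq_smul_add_smul_single hij hv z] at hz
  obtain ⟨D, hg⟩ := hpsh.logSub hpos husc hhom v e
  obtain ⟨E, hk⟩ := hpsh.logSub hpos husc hhom e v
  refine hg.exists_sublevel_decay (hpsh.exists_line_ne hpos husc hhom hz)
    (hg.isBoundedUnder_lelongQuot hk (fun w hw => ?_) ?_) h0 ht
  · rw [← hhom, smul_add, smul_smul, mul_inv_cancel₀ hw, one_smul, add_comm]
  · rw [add_comm] at hz
    exact hpsh.exists_line_ne hpos husc hhom hz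

lemma LogPSH.memL2h_of_lelong_eq_zero (hpos : ∀ z, 0 ≤ h z) (husc : UpperSemicontinuous h)
    (hhom : AbsHomog h) (hpsh : LogPSH h) (hne : ∃ z, h z ≠ 0)
    (hlel : ∀ v : Fin 2 → ℂ, v ≠ 0 → lelong h v = 0) (P : MvPolynomial (Fin 2) ℂ) :
    MemL2h {z | h z < 1} (fun z => MvPolynomial.eval z P) := by
  refine ⟨P.differentiable_eval.differentiableOn, ?_⟩
  obtain ⟨C, hC, d, hP⟩ := P.exists_norm_eval_le
  have ht : (0 : ℝ) < ((2 * d : ℕ) : ℝ) + 5 := by positivity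
  have hm : Measurable h := husc.measurable
  have hcons : ∀ c z w : ℂ, (![c * z, c * w] : Fin 2 → ℂ) = c • ![z, w] := fun c z w => by simp
  -- decay near the direction of the first coordinate axis
  obtain ⟨ρ, hρ, hdec₁⟩ : ∃ ρ : ℝ, 0 < ρ ∧
      SublevelDecay (fun ζ => h ![1, ζ]) (((2 * d : ℕ) : ℝ) + 5) (Metric.ball 0 ρ) := by
    have hv : (![1, 0] : Fin 2 → ℂ) ≠ 0 := fun h => by simpa using congrFun h 0
    have h0 := hlel _ hv
    rw [lelong_of_eq h (by simp)] at h0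
    obtain ⟨ρ, hρ, hd⟩ := hpsh.exists_sublevelDecay hpos husc hhom hne (i := 1) (j := 0)
      (by decide) (by simp) h0 ht
    refine ⟨ρ, hρ, ?_⟩
    convert hd using 3 with ζ
    ext k
    fin_cases k <;> simp
  have hdec₂ : SublevelDecay (fun ζ => h ![ζ, 1]) (((2 * d : ℕ) : ℝ) + 5)
      (Metric.closedBall 0 ρ⁻¹) := by
    refine SublevelDecay.of_isCompact (isCompact_closedBall _ _) fun x _ => ?_
    have hv : (![x, 1] : Fin 2 → ℂ) ≠ 0 := fun h => by simpa using congrFun h 1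
    have h0 := hlel _ hv
    rw [lelong_of_ne h (by simp)] at h0
    obtain ⟨ρ, hρ, hd⟩ := hpsh.exists_sublevelDecay hpos husc hhom hne (i := 0) (j := 1)
      (by decide) (by simp) h0 ht
    refine ⟨ρ, hρ, SublevelDecay.translate ?_⟩
    convert hd using 3 with ζ
    ext k
    fin_cases k <;> simp
  have hI₂ := lintegral_cone_lt_top (H := fun p => h ![p.1, p.2])
    (hm.comp (by fun_prop)) (fun c z w => by simp only [hcons]; exact hhom c _)
    Metric.isClosed_closedBall.measurableSet (fun ζ hζ => by simpa using hζ) (2 * d) hdec₂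
  have hI₁ := lintegral_cone_lt_top (H := fun p => h ![p.2, p.1])
    (hm.comp (by fun_prop)) (fun c z w => by simp only [hcons]; exact hhom c _)
    measurableSet_ball (fun ζ hζ => by simpa using (Metric.mem_ball.1 hζ).le) (2 * d) hdec₁
  set F : ℂ × ℂ → ℝ≥0∞ := fun p => ENNReal.ofReal ((1 + ‖p.1‖ + ‖p.2‖) ^ (2 * d)) with hF
  set A : Set (ℂ × ℂ) := {p | p.2 ≠ 0 ∧ p.1 / p.2 ∈ Metric.closedBall 0 ρ⁻¹ ∧ h ![p.1, p.2] < 1}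
  set B : Set (ℂ × ℂ) := {p | p.2 ≠ 0 ∧ p.1 / p.2 ∈ Metric.ball 0 ρ ∧ h ![p.2, p.1] < 1}
  have hIB : ∫⁻ p in Prod.swap ⁻¹' B, F p < ⊤ := by
    refine lt_of_eq_of_lt ?_ hI₁
    have hs : MeasurePreserving Prod.swap (volume : Measure (ℂ × ℂ)) volume :=
      Measure.measurePreserving_swap
    rw [← hs.setLIntegral_comp_preimage_emb MeasurableEquiv.prodComm.measurableEmbedding]
    refine lintegral_congr fun p => ?_
    simp only [hF, Prod.fst_swap, Prod.snd_swap]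
    congr 2
    ring
  have hcover : {p : ℂ × ℂ | h ![p.1, p.2] < 1} ⊆ {0} ∪ (A ∪ Prod.swap ⁻¹' B) := by
    rintro ⟨z, w⟩ hp
    by_cases hw : w = 0
    · by_cases hz : z = 0
      · exact Or.inl (by simp [hz, hw])
      · exact Or.inr (Or.inr ⟨hz, by simp [hw, hρ], hp⟩)
    · by_cases hzw : ‖z / w‖ ≤ ρ⁻¹
      · exact Or.inr (Or.inl ⟨hw, by simpa using hzw, hp⟩)
      · refine Or.inr (Or.inr ⟨?_, ?_, hp⟩)
        · rintro rfl
          simp [hρ.le] at hzw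
        · have := inv_lt_of_inv_lt₀ hρ (not_le.1 hzw)
          simpa using this
  have hID : ∫⁻ p in {p : ℂ × ℂ | h ![p.1, p.2] < 1}, F p < ⊤ := by
    refine (lintegral_mono_set hcover).trans_lt ((lintegral_union_le _ _ _).trans_lt ?_)
    refine ENNReal.add_lt_top.2 ⟨?_, (lintegral_union_le _ _ _).trans_lt
      (ENNReal.add_lt_top.2 ⟨hI₂, hIB⟩)⟩
    have h0 : volume ({0} : Set (ℂ × ℂ)) = 0 := by
      rw [Measure.volume_eq_prod]
      exact measure_singleton _
    simp [h0]
  have hID' : ∫⁻ z in {z | h z < 1}, F (z 0, z 1) < ⊤ := by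
    refine lt_of_eq_of_lt ?_ hID
    rw [← (volume_preserving_finTwoArrow ℂ).setLIntegral_comp_preimage_emb
      MeasurableEquiv.finTwoArrow.measurableEmbedding]
    congr 2
    ext z
    have : (![z 0, z 1] : Fin 2 → ℂ) = z := by
      ext k
      fin_cases k <;> rfl
    simp [MeasurableEquiv.finTwoArrow, this]
  calc _ ≤ ∫⁻ z in {z | h z < 1}, ENNReal.ofReal (C ^ 2) * F (z 0, z 1) := by
        refine lintegral_mono fun z => ?_
        change ‖MvPolynomial.eval z P‖ₑ ^ 2 ≤ _
        rw [← ofReal_norm, ← ENNReal.ofReal_pow (norm_nonneg _), hF,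
          ← ENNReal.ofReal_mul (by positivity)]
        apply ENNReal.ofReal_le_ofReal
        rw [mul_comm 2 d, pow_mul, ← mul_pow]
        gcongr
        exact hP z
    _ < ⊤ := by
        rw [lintegral_const_mul _ (by fun_prop)]
        exact ENNReal.mul_lt_top ENNReal.ofReal_lt_top hID'

end

/-- If `h` decays along small discs transverse to `v`, then a large power of a linear form
not vanishing at `v` is not square integrable. -/
lemma AbsHomog.exists_not_memL2h {h : (Fin 2 → ℂ) → ℝ} (hhom : AbsHomog h)
    {i j : Fin 2} (hij : i ≠ j) {v : Fin 2 → ℂ} (hv : v j ≠ 0) {ν : ℝ} (hν : 0 < ν)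
    (hf : ∃ᶠ r in 𝓝[>] (0 : ℝ), ∀ ζ : ℂ, ‖ζ‖ ≤ r →
      h (v + ζ • Pi.single i 1) ≤ Real.exp 1 * r ^ ν) :
    ∃ P : MvPolynomial (Fin 2) ℂ, ¬ MemL2h {z | h z < 1} (fun z => MvPolynomial.eval z P) := by
  set n := Module.finrank ℝ (Fin 2 → ℂ) with hn
  obtain ⟨d, hd⟩ := exists_nat_ge ((n + 1) / (2 * ν))
  rw [div_le_iff₀ (by positivity)] at hd
  refine ⟨(MvPolynomial.C (v j)⁻¹ * MvPolynomial.X j) ^ d, fun hmem => ?_⟩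
  obtain ⟨-, hI⟩ := hmem
  set I := ∫⁻ z in {z | h z < 1}, (‖MvPolynomial.eval z
    ((MvPolynomial.C (v j)⁻¹ * MvPolynomial.X j) ^ d)‖₊ : ℝ≥0∞) ^ 2 with hIdef
  set q := 1 + ‖v i‖ / ‖v j‖ with hq
  have hvj : 0 < ‖v j‖ := norm_pos_iff.2 hv
  have hq0 : 0 < q := by positivity
  set κ := min (‖v j‖ / 4) (2 * q)⁻¹ with hκ
  have hκ0 : 0 < κ := by positivity
  set E := Real.exp 1 with hE
  have hE0 : 0 < E := Real.exp_pos 1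
  set V := volume (Metric.ball (0 : Fin 2 → ℂ) 1) with hV
  set c := (2 * E)⁻¹ ^ (2 * d) * (κ / E) ^ n with hc
  have hc0 : 0 < c := by positivity
  have key : ∃ᶠ r in 𝓝[>] (0 : ℝ), ENNReal.ofReal c * V ≤ ENNReal.ofReal r * I := by
    refine (hf.and_eventually (eventually_mem_Ioo_nhdsGT one_pos)).mono ?_
    rintro r ⟨hr, hr0, hr1⟩
    set T := (E * r ^ ν)⁻¹ with hT
    have hrν : 0 < r ^ ν := Real.rpow_pos_of_pos hr0 _
    have hT0 : 0 < T := by positivity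
    set ε := κ * T * r with hε
    have hε0 : 0 < ε := by positivity
    have hball : ∀ z ∈ Metric.ball (((3 / 4 * T : ℝ) : ℂ) • v) ε,
        h z < 1 ∧ T / 2 ≤ ‖(v j)⁻¹ * z j‖ := by
      intro z hz
      rw [mem_ball_iff_norm] at hz
      have hzk : ∀ k, ‖z k - ((3 / 4 * T : ℝ) : ℂ) * v k‖ < ε := fun k =>
        (norm_le_pi_norm _ k).trans_lt hz
      set a := z j / v j with ha
      have ha1 : ‖a - ((3 / 4 * T : ℝ) : ℂ)‖ < ε / ‖v j‖ := by
        have : a - ((3 / 4 * T : ℝ) : ℂ) = (z j - ((3 / 4 * T : ℝ) : ℂ) * v j) / v j := by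
          rw [ha]; field_simp
        rw [this, norm_div]
        gcongr
        exact hzk j
      have hεv : ε / ‖v j‖ ≤ T / 4 := by
        rw [div_le_iff₀ hvj]
        have h1 : κ ≤ ‖v j‖ / 4 := min_le_left _ _
        calc ε ≤ ‖v j‖ / 4 * T * 1 := by rw [hε]; gcongr
          _ = _ := by ring
      have hTn : ‖((3 / 4 * T : ℝ) : ℂ)‖ = 3 / 4 * T := by
        rw [Complex.norm_real, Real.norm_of_nonneg (by positivity)]
      have ha_lt : ‖a‖ < T := by
        have := norm_le_norm_add_norm_sub' a ((3 / 4 * T : ℝ) : ℂ)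
        linarith
      have ha_gt : T / 2 ≤ ‖a‖ := by
        have := norm_le_norm_add_norm_sub a ((3 / 4 * T : ℝ) : ℂ)
        linarith
      refine ⟨?_, ?_⟩
      · have ha0 : a ≠ 0 := norm_pos_iff.1 (by linarith)
        set b := z i - a * v i with hb
        have hbn : ‖b‖ ≤ ε * q := by
          have : b = (z i - ((3 / 4 * T : ℝ) : ℂ) * v i) - (a - ((3 / 4 * T : ℝ) : ℂ)) * v i := by
            rw [hb]; ring
          rw [this]
          refine (norm_sub_le _ _).trans ?_
          rw [norm_mul]
          calc _ ≤ ε + ε / ‖v j‖ * ‖v i‖ := by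
                gcongr
                exact (hzk i).le
            _ = _ := by rw [hq]; ring
        have hζ : ‖b / a‖ ≤ r := by
          rw [norm_div, div_le_iff₀ (by linarith)]
          calc ‖b‖ ≤ ε * q := hbn
            _ ≤ (2 * q)⁻¹ * T * r * q := by rw [hε]; gcongr; exact min_le_right _ _
            _ = r * (T / 2) := by field_simp
            _ ≤ r * ‖a‖ := by gcongr
        have hzeq : z = a • (v + (b / a) • (Pi.single i 1 : Fin 2 → ℂ)) := by
          rw [smul_add, smul_smul, mul_div_cancel₀ _ ha0]
          exact eq_smul_add_smul_single hij hv z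
        rw [hzeq, hhom]
        calc _ ≤ ‖a‖ * (E * r ^ ν) := by gcongr; exact hr _ hζ
          _ < T * (E * r ^ ν) := by gcongr
          _ = 1 := inv_mul_cancel₀ (by positivity)
      · rwa [mul_comm, ← div_eq_mul_inv]
    have hlow : ENNReal.ofReal ((T / 2) ^ (2 * d)) * (ENNReal.ofReal (ε ^ n) * V) ≤ I := by
      calc _ = ∫⁻ z in Metric.ball (((3 / 4 * T : ℝ) : ℂ) • v) ε,
            ENNReal.ofReal ((T / 2) ^ (2 * d)) := by
            rw [setLIntegral_const, Measure.addHaar_ball _ _ hε0.le]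
        _ ≤ ∫⁻ z in Metric.ball (((3 / 4 * T : ℝ) : ℂ) • v) ε, (‖MvPolynomial.eval z
              ((MvPolynomial.C (v j)⁻¹ * MvPolynomial.X j) ^ d)‖₊ : ℝ≥0∞) ^ 2 := by
            refine setLIntegral_mono' measurableSet_ball fun z hz => ?_
            change _ ≤ ‖MvPolynomial.eval z _‖ₑ ^ 2
            rw [← ofReal_norm, ← ENNReal.ofReal_pow (norm_nonneg _)]
            apply ENNReal.ofReal_le_ofReal
            rw [map_pow, map_mul, MvPolynomial.eval_C, MvPolynomial.eval_X, norm_pow, ← pow_mul,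
              mul_comm d 2]
            gcongr
            exact (hball z hz).2
        _ ≤ I := lintegral_mono_set fun z hz => (hball z hz).1
    refine le_trans ?_ (mul_le_mul_right hlow _)
    rw [← mul_assoc, ← mul_assoc, ← ENNReal.ofReal_mul (by positivity),
      ← ENNReal.ofReal_mul (by positivity)]
    refine mul_le_mul_left (ENNReal.ofReal_le_ofReal ?_) _
    have hrinv : 1 ≤ (r ^ ν)⁻¹ := by
      rw [one_le_inv₀ hrν]
      exact Real.rpow_le_one hr0.le hr1.le hν.le
    have hpow : 1 ≤ r * (r ^ ν)⁻¹ ^ (2 * d) * r ^ n := by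
      rw [← Real.rpow_neg hr0.le, ← Real.rpow_natCast, ← Real.rpow_natCast, ← Real.rpow_mul hr0.le]
      nth_rw 1 [← Real.rpow_one r]
      rw [← Real.rpow_add hr0, ← Real.rpow_add hr0]
      refine Real.one_le_rpow_of_pos_of_le_one_of_nonpos hr0 hr1.le ?_
      push_cast
      linarith
    have hTE : T = E⁻¹ * (r ^ ν)⁻¹ := by rw [hT, mul_inv]
    calc c = c * 1 * 1 := by ring
      _ ≤ c * (r * (r ^ ν)⁻¹ ^ (2 * d) * r ^ n) * (r ^ ν)⁻¹ ^ n := by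
          gcongr
          exact one_le_pow₀ hrinv
      _ = _ := by
          rw [hc, hε, hTE]
          simp only [mul_pow, div_pow, mul_inv, inv_pow]
          field_simp
  have hlim : Tendsto (fun r : ℝ => ENNReal.ofReal r * I) (𝓝[>] 0) (𝓝 (ENNReal.ofReal 0 * I)) :=
    ENNReal.Tendsto.mul_const
      ((ENNReal.continuous_ofReal.tendsto 0).mono_left nhdsWithin_le_nhds) (Or.inr hI.ne)
  have h0 := ge_of_tendsto_of_frequently hlim key
  rw [ENNReal.ofReal_zero, zero_mul, nonpos_iff_eq_zero, mul_eq_zero] at h0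
  rcases h0 with h0 | h0
  · exact absurd h0 (by simpa using hc0)
  · exact absurd h0 (Metric.measure_ball_pos _ _ one_pos).ne'

lemma LogPSH.exists_not_memL2h {h : (Fin 2 → ℂ) → ℝ} (hpos : ∀ z, 0 ≤ h z)
    (husc : UpperSemicontinuous h) (hhom : AbsHomog h) (hpsh : LogPSH h) {v : Fin 2 → ℂ}
    (hv : v ≠ 0) (hlel : lelong h v ≠ 0) :
    ∃ P : MvPolynomial (Fin 2) ℂ, ¬ MemL2h {z | h z < 1} (fun z => MvPolynomial.eval z P) := by
  by_cases hv1 : v 1 = 0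
  · have hv0 : v 0 ≠ 0 := fun h0 => hv (by ext k; fin_cases k <;> simp [h0, hv1])
    rw [lelong_of_eq h hv1] at hlel
    obtain ⟨D, hg⟩ := hpsh.logSub hpos husc hhom v (Pi.single 1 1)
    obtain ⟨ν, hν, hf⟩ := hg.exists_frequently_le_rpow hlel
    exact hhom.exists_not_memL2h (by decide) hv0 hν hf
  · rw [lelong_of_ne h hv1] at hlel
    obtain ⟨D, hg⟩ := hpsh.logSub hpos husc hhom v (Pi.single 0 1)
    obtain ⟨ν, hν, hf⟩ := hg.exists_frequently_le_rpow hlel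
    exact hhom.exists_not_memL2h (by decide) hv1 hν hf

/-- all polynomials belong to `L²_h(D_h)` iff all Lelong numbers of `log h`
vanish. -/
theorem statement_12 (h : (Fin 2 → ℂ) → ℝ)
    (hpos : ∀ z, 0 ≤ h z) (husc : UpperSemicontinuous h) (hhom : AbsHomog h)
    (hpsh : LogPSH h) (hne : ∃ z, h z ≠ 0) :
    (∀ P : MvPolynomial (Fin 2) ℂ, MemL2h {z | h z < 1} (fun z => MvPolynomial.eval z P)) ↔
      ∀ v : Fin 2 → ℂ, v ≠ 0 → lelong h v = 0 := by
  constructor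
  · intro hP v hv
    by_contra hlel
    obtain ⟨P, hnP⟩ := hpsh.exists_not_memL2h hpos husc hhom hv hlel
    exact hnP (hP P)
  · exact fun hlel P => hpsh.memL2h_of_lelong_eq_zero hpos husc hhom hne hlel P
end
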